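/- arXiv:1901.10432 — 2 statements merged into one kernel-verified Lean document; each statement's English description precedes it below -/
import Mathlib

section
/- Let X be an infinite polygonal ℤ²-subshift. Then any two minimal recoding polygons for X that are homothetic (one is the image of the other under a positive dilation composed with a translation) differ by a translation. In particular, if some minimal recoding polygon for X is a triangle, then any two minimal recoding polygons for X differ by a translation. -/
namespace PolygonalShifts

abbrev Z2 : Type := ℤ × ℤ

abbrev Config (A : Type*) : Type _ := Z2 → A

/-- The translation action of `ℤ²` on configurations. -/
def shiftAct {A : Type*} (u : Z2) (x : Config A) : Config A := fun w => x (u + w)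

/-- A `ℤ²`-subshift: a closed (for the product topology, with the alphabet discrete)
and translation-invariant set of configurations. -/
def IsSubshift {A : Type*} (X : Set (Config A)) : Prop :=
  (letI : TopologicalSpace A := ⊥
   IsClosed X) ∧
  ∀ u : Z2, ∀ x ∈ X, shiftAct u x ∈ X

/-- The canonical embedding `ℤ² → ℝ²`. -/
def toR2 (p : Z2) : ℝ × ℝ := ((p.1 : ℝ), (p.2 : ℝ))

/-- `S` X-codes `S'`, for subsets `S, S'` of `ℝ²`. -/
def Codes {A : Type*} (X : Set (Config A)) (S S' : Set (ℝ × ℝ)) : Prop :=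
  ∀ x ∈ X, ∀ x' ∈ X,
    (∀ p : Z2, toR2 p ∈ S → x p = x' p) →
    ∀ p : Z2, toR2 p ∈ S' → x p = x' p

/-- `S` X-codes `S'`, for subsets `S, S'` of `ℤ²`. -/
def CodesZ {A : Type*} (X : Set (Config A)) (S S' : Set Z2) : Prop :=
  ∀ x ∈ X, ∀ x' ∈ X, (∀ p ∈ S, x p = x' p) → ∀ p ∈ S', x p = x' p

/-- `Y` is a recoding of `X` via the finite set `F ⊆ ℤ²`. -/
def IsRecodingVia {A A' : Type*} (X : Set (Config A)) (Y : Set (Config A'))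
    (F : Set Z2) : Prop :=
  letI : TopologicalSpace A := ⊥
  letI : TopologicalSpace A' := ⊥
  ∃ Ψ : X ≃ₜ Y,
    (∀ (u : Z2) (x x' : X), (x' : Config A) = shiftAct u (x : Config A) →
      (↑(Ψ x') : Config A') = shiftAct u (↑(Ψ x) : Config A')) ∧
    (∀ (u : Z2) (x x' : X),
      (↑(Ψ x) : Config A') u = (↑(Ψ x') : Config A') u ↔
        ∀ f ∈ F, (x : Config A) (f + u) = (x' : Config A) (f + u))

/-- `Y` is a recoding of `X`. -/
def IsRecoding {A A' : Type*} (X : Set (Config A)) (Y : Set (Config A')) : Prop :=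
  ∃ F : Set Z2, F.Finite ∧ IsRecodingVia X Y F

/-- Integer cross product. -/
def crossZ (u v : Z2) : ℤ := u.1 * v.2 - u.2 * v.1

/-- Real cross product. -/
def crossR (u v : ℝ × ℝ) : ℝ := u.1 * v.2 - u.2 * v.1

/-- A convex integer polygon, given by its (at least three) vertices listed in
counterclockwise order: every vertex lies strictly to the left of every directed edge. -/
structure IntPolygon where
  n : ℕ
  vert : Fin (n + 3) → Z2
  convex : ∀ i j : Fin (n + 3), j ≠ i → j ≠ i + 1 →
    0 < crossZ (vert (i + 1) - vert i) (vert j - vert i)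

namespace IntPolygon

/-- The oriented edge vector from vertex `i` to vertex `i+1`. -/
def edgeVec (P : IntPolygon) (i : Fin (P.n + 3)) : Z2 := P.vert (i + 1) - P.vert i

/-- The polygon as a subset of `ℝ²` (the convex hull of its vertices). -/
def carrier (P : IntPolygon) : Set (ℝ × ℝ) :=
  convexHull ℝ (Set.range fun i => toR2 (P.vert i))

lemma crossZ_smul (m : ℤ) (u v : Z2) : crossZ (m • u) (m • v) = m ^ 2 * crossZ u v := by
  simp only [crossZ, Prod.smul_fst, Prod.smul_snd, smul_eq_mul]
  ring

/-- The dilation of a polygon by a positive integer factor about the origin. -/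
def dilate (P : IntPolygon) (m : ℤ) (hm : 0 < m) : IntPolygon where
  n := P.n
  vert := fun i => m • P.vert i
  convex := by
    intro i j hj hj1
    have h := P.convex i j hj hj1
    have e1 : m • P.vert (i + 1) - m • P.vert i = m • (P.vert (i + 1) - P.vert i) :=
      (smul_sub m _ _).symm
    have e2 : m • P.vert j - m • P.vert i = m • (P.vert j - P.vert i) :=
      (smul_sub m _ _).symm
    rw [e1, e2, crossZ_smul]
    exact mul_pos (pow_pos hm 2) h

end IntPolygon

/-- `P` is a coding polygon for `X`: for each vertex `w`, the polygon with `w`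
removed X-codes `w`. -/
def IsCodingPolygon {A : Type*} (X : Set (Config A)) (P : IntPolygon) : Prop :=
  ∀ i : Fin (P.n + 3),
    Codes X (P.carrier \ {toR2 (P.vert i)}) {toR2 (P.vert i)}

/-- `X` is polygonal with respect to `P`. -/
def Polygonal {A : Type*} (X : Set (Config A)) (P : IntPolygon) : Prop :=
  X.Infinite ∧ IsCodingPolygon X P

/-- The closed half plane `H_v = {w : v₁ w₂ − v₂ w₁ ≥ 0}` to the left of the direction `v`. -/
def leftHalfPlane (v : ℝ × ℝ) : Set (ℝ × ℝ) := {w | 0 ≤ v.1 * w.2 - v.2 * w.1}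

/-- The ray directed by `v` is expansive for `X`: `H_v` X-codes all of `ℝ²`. -/
def ExpansiveRay {A : Type*} (X : Set (Config A)) (v : ℝ × ℝ) : Prop :=
  Codes X (leftHalfPlane v) Set.univ

/-- For a primitive integer direction `v`, the line `L₀`: the translate of `L = ℝ·v`
by an integer vector, lying outside `H_v` and closest to `L`. -/
def lineL0 (v : Z2) : Set (ℝ × ℝ) := {w | (v.1 : ℝ) * w.2 - (v.2 : ℝ) * w.1 = -1}

/-- A block of `m` consecutive lattice points on `L₀`, starting at `z`. -/
def blockOn (v z : Z2) (m : ℕ) : Set (ℝ × ℝ) :=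
  (fun k : ℕ => toR2 (z + (k : ℤ) • v)) '' {k | k < m}

/-- The (nonexpansive) rational ray directed by the primitive vector `v` is closing for `X`. -/
def ClosingRay {A : Type*} (X : Set (Config A)) (v : Z2) : Prop :=
  ∃ N : ℕ, ∀ z : Z2, v.1 * z.2 - v.2 * z.1 = -1 →
    ∀ m : ℕ, N ≤ m →
      Codes X (leftHalfPlane (toR2 v) ∪ blockOn v z m) (lineL0 v)

/-- The sector (with vertex the origin) determined by the rays through `e₁` and `e₂`:
lattice points on either ray or strictly between them. -/
def SectorZ (e₁ e₂ : Z2) : Set Z2 :=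
  {p | SameRay ℝ (toR2 e₁) (toR2 p) ∨ SameRay ℝ (toR2 e₂) (toR2 p) ∨
       (0 < crossZ e₁ p ∧ 0 < crossZ p e₂)}

/-- The rational sector determined by `(e₁, e₂)` is corner coding for `X`. -/
def IsCornerCoding {A : Type*} (X : Set (Config A)) (e₁ e₂ : Z2) : Prop :=
  CodesZ X (SectorZ e₁ e₂ \ {0}) {0}

/-- The rational sector determined by `(e₁, e₂)` is weakly corner coding for `X`. -/
def IsWeaklyCornerCoding {A : Type*} (X : Set (Config A)) (e₁ e₂ : Z2) : Prop :=
  ∃ F₀ : Set Z2, F₀.Finite ∧ F₀ ⊆ SectorZ e₁ e₂ ∧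
    ∀ F : Set Z2, F.Finite → F ⊆ SectorZ e₁ e₂ →
      CodesZ X (SectorZ e₁ e₂ \ F) (SectorZ e₁ e₂ \ F₀)

/-- The sector based at the vertex `i` of the polygon `P`: lattice points in the convex
cone with apex `P.vert i` spanned by the two edges of `P` incident to that vertex. -/
def vertexSector (P : IntPolygon) (i : Fin (P.n + 3)) : Set Z2 :=
  {p | ∃ s t : ℝ, 0 ≤ s ∧ 0 ≤ t ∧
    toR2 p = toR2 (P.vert i) + s • toR2 (P.vert (i - 1) - P.vert i)
      + t • toR2 (P.vert (i + 1) - P.vert i)}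

/-- `P` is a coding polygon for some recoding of `X`. -/
def HasRecodingPolygon {A : Type*} (X : Set (Config A)) (P : IntPolygon) : Prop :=
  ∃ (A' : Type) (_ : Fintype A') (Y : Set (Config A')),
    IsSubshift Y ∧ IsRecoding X Y ∧ IsCodingPolygon Y P

/-- `P` is a minimal recoding polygon for `X`. -/
def IsMinimalRecodingPolygon {A : Type*} (X : Set (Config A)) (P : IntPolygon) : Prop :=
  HasRecodingPolygon X P ∧
  (∀ Q : IntPolygon, HasRecodingPolygon X Q → P.n ≤ Q.n) ∧
  (∀ Q : IntPolygon, HasRecodingPolygon X Q → Q.n = P.n →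
    Q.carrier ⊆ P.carrier → Q.carrier = P.carrier)


/-- `Q` is the image of `P` under a positive dilation composed with a translation. -/
def Homothetic (P Q : IntPolygon) : Prop :=
  ∃ r : ℝ, 0 < r ∧ ∃ t : ℝ × ℝ, Q.carrier = (fun w => r • w + t) '' P.carrier

/-- `Q` is a translate of `P`. -/
def TranslateOf (P Q : IntPolygon) : Prop :=
  ∃ t : ℝ × ℝ, Q.carrier = (fun w => w + t) '' P.carrier

section Coding

variable {A A' : Type*}

lemma CodesZ.shift {X : Set (Config A)} (hX : IsSubshift X) {S T : Set Z2}
    (h : CodesZ X S T) (u : Z2) {x x' : Config A} (hx : x ∈ X) (hx' : x' ∈ X)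
    (hS : ∀ q ∈ S, x (u + q) = x' (u + q)) : ∀ p ∈ T, x (u + p) = x' (u + p) :=
  h _ (hX.2 u x hx) _ (hX.2 u x' hx') hS

/-- A finite subset of the open half plane to the left of `e` codes the origin. -/
def FinitelyExpansive (X : Set (Config A)) (e : Z2) : Prop :=
  ∃ S : Set Z2, S.Finite ∧ (∀ q ∈ S, 0 < crossZ e q) ∧ CodesZ X S {0}

lemma crossZ_add_right (e p q : Z2) : crossZ e (p + q) = crossZ e p + crossZ e q := by
  simp only [crossZ, Prod.fst_add, Prod.snd_add]; ring

lemma FinitelyExpansive.exists_codes {X : Set (Config A)} (hX : IsSubshift X) {e : Z2}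
    (h : FinitelyExpansive X e) (M : ℤ) (p : Z2) :
    ∃ S : Set Z2, S.Finite ∧ (∀ q ∈ S, M ≤ crossZ e q) ∧ CodesZ X S {p} := by
  obtain ⟨S, hSfin, hSpos, hS⟩ := h
  induction hk : (M - crossZ e p).toNat using Nat.strong_induction_on generalizing p with
  | _ k ih =>
    subst hk
    by_cases hp : M ≤ crossZ e p
    · exact ⟨{p}, Set.finite_singleton p, by simpa using hp, fun x _ x' _ h => h⟩
    · have key : ∀ q ∈ S, ∃ R : Set Z2, R.Finite ∧ (∀ r ∈ R, M ≤ crossZ e r) ∧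
          CodesZ X R {p + q} := by
        intro q hq
        refine ih _ ?_ (p + q) rfl
        have := hSpos q hq
        rw [crossZ_add_right]
        omega
      choose! R hRfin hRpos hR using key
      refine ⟨⋃ q ∈ S, R q, hSfin.biUnion hRfin, ?_, ?_⟩
      · intro r hr
        simp only [Set.mem_iUnion] at hr
        obtain ⟨q, hq, hr⟩ := hr
        exact hRpos q hq r hr
      · intro x hx x' hx' hxx
        have := hS.shift hX p hx hx' fun q hq => hR q hq x hx x' hx'
          (fun r hr => hxx r (Set.mem_biUnion hq hr)) _ rfl
        simpa using this

lemma exists_le_crossZ {F : Set Z2} (hF : F.Finite) (e : Z2) : ∃ m, ∀ f ∈ F, m ≤ crossZ e f := by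
  obtain ⟨m, hm⟩ := (hF.image (crossZ e)).bddBelow
  exact ⟨m, fun f hf => hm ⟨f, hf, rfl⟩⟩

lemma FinitelyExpansive.of_recoding {X : Set (Config A)} {Y : Set (Config A')} {e : Z2}
    (hXinf : X.Infinite) (hY : IsSubshift Y) (hXY : IsRecoding X Y)
    (h : FinitelyExpansive Y e) : FinitelyExpansive X e := by
  let : TopologicalSpace A := ⊥
  let : TopologicalSpace A' := ⊥
  obtain ⟨F, hF, Ψ, -, hΨ⟩ := hXY
  obtain ⟨f₀, hf₀⟩ : F.Nonempty := by
    by_contra hne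
    rw [Set.not_nonempty_iff_eq_empty] at hne
    subst hne
    refine hXinf (Set.Subsingleton.finite fun x hx x' hx' => ?_)
    have : Ψ ⟨x, hx⟩ = Ψ ⟨x', hx'⟩ := Subtype.ext (funext fun u => (hΨ u _ _).2 (by simp))
    exact congrArg Subtype.val (Ψ.injective this)
  obtain ⟨m, hm⟩ := exists_le_crossZ hF e
  obtain ⟨S, hSfin, hSpos, hS⟩ := h.exists_codes hY (1 - m) (-f₀)
  refine ⟨Set.image2 (· + ·) F S, hF.image2 _ hSfin, ?_, ?_⟩
  · rintro _ ⟨f, hf, s, hs, rfl⟩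
    have h1 := hm f hf
    have h2 := hSpos s hs
    simp only [crossZ_add_right]
    omega
  · intro x hx x' hx' hxx
    have := (hΨ (-f₀) ⟨x, hx⟩ ⟨x', hx'⟩).1 (hS _ (Ψ _).2 _ (Ψ _).2
      (fun s hs => (hΨ s ⟨x, hx⟩ ⟨x', hx'⟩).2 fun f hf => hxx _ ⟨f, hf, s, hs, rfl⟩) _ rfl) f₀ hf₀
    simpa using this

/-- An injective continuous map out of a compact set of configurations has a finite window
determining the symbol at the origin. -/
lemma exists_finite_window [TopologicalSpace A] [DiscreteTopology A] [TopologicalSpace A']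
    [DiscreteTopology A'] [Finite A] {X : Set (Config A)} {Y : Set (Config A')}
    (hX : IsClosed X) {Ψ : X → Y} (hc : Continuous Ψ) (hi : Function.Injective Ψ) :
    ∃ G : Set Z2, G.Finite ∧ ∀ x x' : X,
      (∀ g ∈ G, (Ψ x : Config A') g = (Ψ x' : Config A') g) →
        (x : Config A) 0 = (x' : Config A) 0 := by
  have : CompactSpace X := isCompact_iff_compactSpace.1 hX.isCompact
  have isClopen_ne : ∀ {B : Type _} [TopologicalSpace B] [DiscreteTopology B] (f : X → B),
      Continuous f → IsClopen {z : X × X | f z.1 ≠ f z.2} := fun f hf =>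
    (isClopen_discrete {w : _ × _ | w.1 ≠ w.2}).preimage
      ((hf.comp continuous_fst).prodMk (hf.comp continuous_snd))
  have hK : IsCompact {z : X × X | (z.1 : Config A) 0 ≠ (z.2 : Config A) 0} :=
    (isClopen_ne (fun x : X => (x : Config A) 0)
      ((continuous_apply 0).comp continuous_subtype_val)).isClosed.isCompact
  have hU : ∀ g : Z2, IsOpen {z : X × X | (Ψ z.1 : Config A') g ≠ (Ψ z.2 : Config A') g} :=
    fun g => ((isClopen_discrete {w : A' × A' | w.1 ≠ w.2}).preimage
      ((((continuous_apply g).comp (continuous_subtype_val.comp hc)).comp continuous_fst).prodMk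
        (((continuous_apply g).comp (continuous_subtype_val.comp hc)).comp
          continuous_snd))).isOpen
  obtain ⟨G, hG⟩ := hK.elim_finite_subcover _ hU (by
    intro z hz
    by_contra hne
    simp only [Set.mem_iUnion, Set.mem_ofPred_eq, not_exists, not_not] at hne
    exact hz (by rw [hi (Subtype.ext (funext hne))]))
  refine ⟨G, G.finite_toSet, fun x x' h => ?_⟩
  by_contra hne
  have := hG (show (x, x') ∈ _ from hne)
  simp only [Set.mem_iUnion, Set.mem_ofPred_eq] at this
  obtain ⟨g, hg, hne'⟩ := this
  exact hne' (h g hg)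

lemma FinitelyExpansive.recoding [Finite A] {X : Set (Config A)} {Y : Set (Config A')} {e : Z2}
    (hX : IsSubshift X) (hXY : IsRecoding X Y) (h : FinitelyExpansive X e) :
    FinitelyExpansive Y e := by
  let : TopologicalSpace A := ⊥
  let : TopologicalSpace A' := ⊥
  obtain ⟨F, hF, Ψ, hequi, hΨ⟩ := hXY
  obtain ⟨G, hG, hGΨ⟩ : ∃ G : Set Z2, G.Finite ∧ ∀ x x' : X,
      (∀ g ∈ G, (Ψ x : Config A') g = (Ψ x' : Config A') g) →
        (x : Config A) 0 = (x' : Config A) 0 := by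
    have : DiscreteTopology A := ⟨rfl⟩
    have : DiscreteTopology A' := ⟨rfl⟩
    exact exists_finite_window hX.1 Ψ.continuous Ψ.injective
  obtain ⟨m, hm⟩ := exists_le_crossZ hG e
  choose S hSfin hSpos hS using fun f => h.exists_codes hX (1 - m) f
  refine ⟨Set.image2 (· + ·) (⋃ f ∈ F, S f) G,
    (hF.biUnion fun f _ => hSfin f).image2 _ hG, ?_, ?_⟩
  · rintro _ ⟨s, hs, g, hg, rfl⟩
    simp only [Set.mem_iUnion] at hs
    obtain ⟨f, -, hs⟩ := hs
    have h1 := hm g hg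
    have h2 := hSpos f s hs
    simp only [crossZ_add_right]
    omega
  · intro y hy y' hy' hyy p hp
    obtain rfl : p = 0 := hp
    obtain ⟨x, hx⟩ := Ψ.surjective ⟨y, hy⟩
    obtain ⟨x', hx'⟩ := Ψ.surjective ⟨y', hy'⟩
    have e1 : y = Ψ x := by rw [hx]
    have e2 : y' = Ψ x' := by rw [hx']
    rw [e1, e2]
    refine (hΨ 0 x x').2 fun f hf => ?_
    refine hS f x x.2 x' x'.2 (fun s hs => ?_) _ (by simp)
    have := hGΨ ⟨_, hX.2 s x x.2⟩ ⟨_, hX.2 s x' x'.2⟩ (fun g hg => by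
      rw [hequi s x ⟨_, hX.2 s x x.2⟩ rfl, hequi s x' ⟨_, hX.2 s x' x'.2⟩ rfl, ← e1, ← e2]
      exact hyy _ ⟨s, Set.mem_biUnion hf hs, g, hg, rfl⟩)
    simpa [shiftAct] using this

end Coding

section Triangle

variable {A : Type*}

/-- The lattice points of the triangle with counterclockwise vertices `a`, `b`, `c`. -/
def triZ (a b c : Z2) : Set Z2 :=
  {p | 0 ≤ crossZ (b - a) (p - a) ∧ 0 ≤ crossZ (c - b) (p - b) ∧ 0 ≤ crossZ (a - c) (p - c)}

/-- The triangle with counterclockwise vertices `a`, `b`, `c` is a coding polygon. -/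
structure CodingTriangle (X : Set (Config A)) (a b c : Z2) : Prop where
  pos : 0 < crossZ (b - a) (c - a)
  codes₁ : CodesZ X (triZ a b c \ {a}) {a}
  codes₂ : CodesZ X (triZ a b c \ {b}) {b}
  codes₃ : CodesZ X (triZ a b c \ {c}) {c}

lemma triZ_rotate (a b c : Z2) : triZ b c a = triZ a b c := by
  ext p; simp only [triZ, Set.mem_ofPred_eq]; tauto

lemma crossZ_rotate (a b c : Z2) : crossZ (c - b) (a - b) = crossZ (b - a) (c - a) := by
  simp only [crossZ, Prod.fst_sub, Prod.snd_sub]; ring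

lemma CodingTriangle.rotate {X : Set (Config A)} {a b c : Z2} (h : CodingTriangle X a b c) :
    CodingTriangle X b c a where
  pos := by rw [crossZ_rotate]; exact h.pos
  codes₁ := by rw [triZ_rotate]; exact h.codes₂
  codes₂ := by rw [triZ_rotate]; exact h.codes₃
  codes₃ := by rw [triZ_rotate]; exact h.codes₁

/-- A vector is determined by its cross products with two independent vectors. -/
lemma eq_zero_of_crossZ {u v p : Z2} (h : crossZ u v ≠ 0) (h1 : crossZ u p = 0)
    (h2 : crossZ v p = 0) : p = 0 := by
  simp only [crossZ] at h h1 h2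
  have e1 : (u.1 * v.2 - u.2 * v.1) * p.1 = 0 := by linear_combination v.1 * h1 - u.1 * h2
  have e2 : (u.1 * v.2 - u.2 * v.1) * p.2 = 0 := by linear_combination v.2 * h1 - u.2 * h2
  exact Prod.ext ((mul_eq_zero.1 e1).resolve_left h) ((mul_eq_zero.1 e2).resolve_left h)

lemma finite_of_crossZ_bounded {u v : Z2} (h : crossZ u v ≠ 0) (L : ℤ) :
    {p : Z2 | |crossZ u p| ≤ L ∧ |crossZ v p| ≤ L}.Finite := by
  refine Set.Finite.of_finite_image (f := fun p => (crossZ u p, crossZ v p))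
    ((Set.finite_Icc ((-L, -L) : ℤ × ℤ) (L, L)).subset ?_) ?_
  · rintro _ ⟨p, ⟨h1, h2⟩, rfl⟩
    exact ⟨⟨(abs_le.1 h1).1, (abs_le.1 h2).1⟩, ⟨(abs_le.1 h1).2, (abs_le.1 h2).2⟩⟩
  · rintro p - q - hpq
    simp only [Prod.mk.injEq] at hpq
    refine sub_eq_zero.1 (eq_zero_of_crossZ h ?_ ?_)
    · have := hpq.1
      simp only [crossZ, Prod.fst_sub, Prod.snd_sub] at *
      linarith
    · have := hpq.2
      simp only [crossZ, Prod.fst_sub, Prod.snd_sub] at *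
      linarith

lemma finite_triZ {a b c : Z2} (h : 0 < crossZ (b - a) (c - a)) : (triZ a b c).Finite := by
  refine (((finite_of_crossZ_bounded (u := b - a) (v := c - a) h.ne'
    (crossZ (b - a) (c - a))).image (· + a))).subset ?_
  rintro p ⟨h1, h2, h3⟩
  refine ⟨p - a, ⟨?_, ?_⟩, by simp⟩ <;> rw [abs_le] <;>
    simp only [crossZ, Prod.fst_sub, Prod.snd_sub] at * <;> constructor <;> linarith

lemma CodingTriangle.finitelyExpansive_of_pos {X : Set (Config A)} (hX : IsSubshift X)
    {a b c e : Z2} (h : CodingTriangle X a b c) (hb : 0 < crossZ e (b - a))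
    (hc : 0 < crossZ e (c - a)) : FinitelyExpansive X e := by
  refine ⟨(· - a) '' (triZ a b c \ {a}), ((finite_triZ h.pos).subset Set.sdiff_subset).image _,
    ?_, ?_⟩
  · rintro _ ⟨p, ⟨⟨h1, -, h3⟩, hpa⟩, rfl⟩
    have hD := h.pos
    have key : crossZ (b - a) (c - a) * crossZ e (p - a) =
        crossZ (a - c) (p - c) * crossZ e (b - a) + crossZ (b - a) (p - a) * crossZ e (c - a) := by
      simp only [crossZ, Prod.fst_sub, Prod.snd_sub]; ring
    refine pos_of_mul_pos_right (a := crossZ (b - a) (c - a)) ?_ hD.le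
    rw [key]
    rcases h1.lt_or_eq with h1 | h1
    · have := mul_pos h1 hc
      have := mul_nonneg h3 hb.le
      linarith
    rcases h3.lt_or_eq with h3 | h3
    · have := mul_pos h3 hb
      rw [← h1]; linarith
    · refine absurd (sub_eq_zero.1 (eq_zero_of_crossZ hD.ne' h1.symm ?_)) hpa
      simp only [crossZ, Prod.fst_sub, Prod.snd_sub] at *
      linarith
  · intro x hx x' hx' hxx p hp
    obtain rfl : p = 0 := hp
    have := h.codes₁.shift hX (-a) hx hx'
      (fun q hq => hxx _ ⟨q, hq, by simp [sub_eq_neg_add]⟩) a rfl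
    simpa using this

/-- `e` is a positive multiple of `b - a`, where `a`, `b`, `c` is a counterclockwise triangle. -/
def AlongEdge (e a b c : Z2) : Prop := crossZ e (b - a) = 0 ∧ 0 < crossZ e (c - a)

lemma CodingTriangle.alongEdge {X : Set (Config A)} (hX : IsSubshift X)
    {a b c e : Z2} (h : CodingTriangle X a b c) (he : e ≠ 0) (hexp : ¬ FinitelyExpansive X e) :
    AlongEdge e a b c ∨ AlongEdge e b c a ∨ AlongEdge e c a b := by
  have ha := mt (fun h' => h.finitelyExpansive_of_pos hX (e := e) (And.left h') (And.right h')) hexp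
  have hb := mt (fun h' => h.rotate.finitelyExpansive_of_pos hX (e := e)
    (And.left h') (And.right h')) hexp
  have hc := mt (fun h' => h.rotate.rotate.finitelyExpansive_of_pos hX (e := e)
    (And.left h') (And.right h')) hexp
  have hne : ¬ (crossZ e (b - a) = 0 ∧ crossZ e (c - a) = 0) := fun ⟨h1, h2⟩ => by
    refine he (eq_zero_of_crossZ h.pos.ne' ?_ ?_)
    · simp only [crossZ] at *; linarith
    · simp only [crossZ] at *; linarith
  have e1 : crossZ e (c - b) = crossZ e (c - a) - crossZ e (b - a) := by
    simp only [crossZ, Prod.fst_sub, Prod.snd_sub]; ring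
  have e2 : crossZ e (a - b) = - crossZ e (b - a) := by
    simp only [crossZ, Prod.fst_sub, Prod.snd_sub]; ring
  have e3 : crossZ e (b - c) = crossZ e (b - a) - crossZ e (c - a) := by
    simp only [crossZ, Prod.fst_sub, Prod.snd_sub]; ring
  have e4 : crossZ e (a - c) = - crossZ e (c - a) := by
    simp only [crossZ, Prod.fst_sub, Prod.snd_sub]; ring
  simp only [AlongEdge]
  rw [e1, e2] at hb
  rw [e3, e4] at hc
  rw [e1, e2, e3, e4]
  omega

/-- The triangle of height `M` with apex at the origin and sides parallel to those of the
triangle with counterclockwise vertices `a`, `b`, `c`. -/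
def apexTri (a b c : Z2) (M : ℤ) : Set Z2 :=
  {p | -M ≤ crossZ (b - a) p ∧ 0 ≤ crossZ (c - b) p ∧ 0 ≤ crossZ (a - c) p}

lemma crossZ_edges_sum (a b c p : Z2) :
    crossZ (b - a) p + crossZ (c - b) p + crossZ (a - c) p = 0 := by
  simp only [crossZ, Prod.fst_sub, Prod.snd_sub]; ring

lemma CodingTriangle.exists_apexTri_codes_succ {X : Set (Config A)} (hX : IsSubshift X)
    {a b c : Z2} (h : CodingTriangle X a b c) (hexp : FinitelyExpansive X (b - a)) :
    ∃ M₀ : ℤ, ∀ M, M₀ ≤ M → CodesZ X (apexTri a b c M) (apexTri a b c (M + 1)) := by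
  obtain ⟨S, hSfin, hSpos, hS⟩ := hexp
  obtain ⟨m₂, hm₂⟩ := exists_le_crossZ hSfin (c - b)
  obtain ⟨m₃, hm₃⟩ := exists_le_crossZ hSfin (a - c)
  obtain ⟨B, hB0, hB2, hB3⟩ : ∃ B : ℤ, 0 ≤ B ∧ -B ≤ m₂ ∧ -B ≤ m₃ :=
    ⟨max 0 (max (-m₂) (-m₃)), by omega, by omega, by omega⟩
  have hD := h.pos
  set D := crossZ (b - a) (c - a) with hDdef
  refine ⟨2 * B + D, fun M hM x hx x' hx' hxx => ?_⟩
  have hmid : ∀ p, crossZ (b - a) p = -M - 1 → B ≤ crossZ (c - b) p → B ≤ crossZ (a - c) p →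
      x p = x' p := by
    intro p h1 h2 h3
    have := hS.shift hX p hx hx' (fun q hq => hxx _ ?_) 0 rfl
    · simpa using this
    · have g1 := hSpos q hq
      have g2 := hm₂ q hq
      have g3 := hm₃ q hq
      simp only [apexTri, Set.mem_ofPred_eq, crossZ_add_right]
      omega
  have hleft : ∀ k : ℕ, ∀ p, crossZ (b - a) p = -M - 1 → B ≤ crossZ (c - b) p →
      0 ≤ crossZ (a - c) p → (crossZ (c - b) p).toNat = k → x p = x' p := by
    intro k
    induction k using Nat.strong_induction_on with
    | _ k ih =>
      intro p h1 h2 h3 hk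
      by_cases h3' : B ≤ crossZ (a - c) p
      · exact hmid p h1 h2 h3'
      have hsum := crossZ_edges_sum a b c p
      have := h.codes₁.shift hX (p - a) hx hx' (fun q hq => ?_) a rfl
      · simpa using this
      · obtain ⟨⟨q1, q2, q3⟩, hqa⟩ := hq
        have e1 : crossZ (b - a) (p - a + q) = crossZ (b - a) p + crossZ (b - a) (q - a) := by
          simp only [crossZ, Prod.fst_sub, Prod.snd_sub, Prod.fst_add, Prod.snd_add]; ring
        have e2 : crossZ (c - b) (p - a + q) = crossZ (c - b) p + crossZ (c - b) (q - b) - D := by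
          simp only [hDdef, crossZ, Prod.fst_sub, Prod.snd_sub, Prod.fst_add, Prod.snd_add]; ring
        have e3 : crossZ (a - c) (p - a + q) = crossZ (a - c) p + crossZ (a - c) (q - c) := by
          simp only [crossZ, Prod.fst_sub, Prod.snd_sub, Prod.fst_add, Prod.snd_add]; ring
        have hsum' := crossZ_edges_sum a b c (p - a + q)
        by_cases hq1 : crossZ (b - a) (q - a) = 0
        · have hq3 : crossZ (a - c) (q - c) ≠ 0 := fun h0 => by
            refine hqa (sub_eq_zero.1 (eq_zero_of_crossZ hD.ne' hq1 ?_))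
            simp only [crossZ, Prod.fst_sub, Prod.snd_sub] at *
            linarith
          exact ih _ (by omega) (p - a + q) (by omega) (by omega) (by omega) rfl
        · refine hxx _ ⟨?_, ?_, ?_⟩ <;> omega
  have hright : ∀ k : ℕ, ∀ p, crossZ (b - a) p = -M - 1 → 0 ≤ crossZ (c - b) p →
      B ≤ crossZ (a - c) p → (crossZ (a - c) p).toNat = k → x p = x' p := by
    intro k
    induction k using Nat.strong_induction_on with
    | _ k ih =>
      intro p h1 h2 h3 hk
      by_cases h2' : B ≤ crossZ (c - b) p
      · exact hmid p h1 h2' h3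
      have hsum := crossZ_edges_sum a b c p
      have := h.codes₂.shift hX (p - b) hx hx' (fun q hq => ?_) b rfl
      · simpa using this
      · obtain ⟨⟨q1, q2, q3⟩, hqb⟩ := hq
        have e1 : crossZ (b - a) (p - b + q) = crossZ (b - a) p + crossZ (b - a) (q - a) := by
          simp only [crossZ, Prod.fst_sub, Prod.snd_sub, Prod.fst_add, Prod.snd_add]; ring
        have e2 : crossZ (c - b) (p - b + q) = crossZ (c - b) p + crossZ (c - b) (q - b) := by
          simp only [crossZ, Prod.fst_sub, Prod.snd_sub, Prod.fst_add, Prod.snd_add]; ring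
        have e3 : crossZ (a - c) (p - b + q) = crossZ (a - c) p + crossZ (a - c) (q - c) - D := by
          simp only [hDdef, crossZ, Prod.fst_sub, Prod.snd_sub, Prod.fst_add, Prod.snd_add]; ring
        have hsum' := crossZ_edges_sum a b c (p - b + q)
        by_cases hq1 : crossZ (b - a) (q - a) = 0
        · have hq2 : crossZ (c - b) (q - b) ≠ 0 := fun h0 => by
            refine hqb (sub_eq_zero.1 (eq_zero_of_crossZ (u := b - a) (v := c - b) ?_ ?_ h0))
            · have : crossZ (b - a) (c - b) = D := by
                simp only [hDdef, crossZ, Prod.fst_sub, Prod.snd_sub]; ring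
              omega
            · simp only [crossZ, Prod.fst_sub, Prod.snd_sub] at *
              linarith
          exact ih _ (by omega) (p - b + q) (by omega) (by omega) (by omega) rfl
        · refine hxx _ ⟨?_, ?_, ?_⟩ <;> omega
  rintro p ⟨h1, h2, h3⟩
  by_cases hp : -M ≤ crossZ (b - a) p
  · exact hxx p ⟨hp, h2, h3⟩
  have hsum := crossZ_edges_sum a b c p
  by_cases hB : B ≤ crossZ (c - b) p
  · exact hleft _ p (by omega) hB h3 rfl
  · exact hright _ p (by omega) h2 (by omega) rfl

/-- If an edge direction of a coding triangle is expansive, a finite set codes the whole cone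
at the opposite vertex. -/
lemma CodingTriangle.exists_finite_codes_cone {X : Set (Config A)} (hX : IsSubshift X)
    {a b c : Z2} (h : CodingTriangle X a b c) (hexp : FinitelyExpansive X (b - a)) :
    ∃ T : Set Z2, T.Finite ∧ CodesZ X T {p | 0 ≤ crossZ (c - b) p ∧ 0 ≤ crossZ (a - c) p} := by
  obtain ⟨M₀, hM₀⟩ := h.exists_apexTri_codes_succ hX hexp
  refine ⟨apexTri a b c M₀, ?_, ?_⟩
  · have hD : crossZ (c - b) (a - c) ≠ 0 := by
      have h1 := h.pos
      have h2 : crossZ (c - b) (a - c) = crossZ (b - a) (c - a) := by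
        simp only [crossZ, Prod.fst_sub, Prod.snd_sub]; ring
      omega
    refine (finite_of_crossZ_bounded hD M₀).subset ?_
    rintro p ⟨h1, h2, h3⟩
    have hsum := crossZ_edges_sum a b c p
    constructor <;> rw [abs_le] <;> constructor <;> omega
  · intro x hx x' hx' hxx p ⟨h2, h3⟩
    have key : ∀ k : ℕ, ∀ q ∈ apexTri a b c (M₀ + k), x q = x' q := by
      intro k
      induction k with
      | zero => simpa using hxx
      | succ k ih =>
        have := hM₀ (M₀ + k) (by omega) x hx x' hx' ih
        rw [add_assoc] at this
        exact_mod_cast this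
    exact key (-crossZ (b - a) p - M₀).toNat p ⟨by omega, h2, h3⟩

lemma CodingTriangle.finite_of_finitelyExpansive [Finite A] {X : Set (Config A)}
    (hX : IsSubshift X) {a b c : Z2} (h : CodingTriangle X a b c)
    (hexp : FinitelyExpansive X (b - a)) : X.Finite := by
  obtain ⟨T, hT, hcone⟩ := h.exists_finite_codes_cone hX hexp
  by_contra hinf
  have := hT.to_subtype
  obtain ⟨s, hsX, hs⟩ := Set.Infinite.exists_subset_card_eq hinf (Nat.card (T → A) + 1)
  have hdiff : ∀ z : Config A × Config A, ∃ d : Z2, z.1 ≠ z.2 → z.1 d ≠ z.2 d := by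
    intro z
    by_cases hz : z.1 = z.2
    · exact ⟨0, fun h => absurd hz h⟩
    · obtain ⟨d, hd⟩ := Function.ne_iff.1 hz
      exact ⟨d, fun _ => hd⟩
  choose d hd using hdiff
  have hfin : (d '' (s ×ˢ s : Finset (Config A × Config A))).Finite := (Finset.finite_toSet _).image d
  obtain ⟨m₂, hm₂⟩ := exists_le_crossZ hfin (c - b)
  obtain ⟨m₃, hm₃⟩ := exists_le_crossZ hfin (a - c)
  obtain ⟨w, hw2, hw3⟩ : ∃ w : Z2, -m₂ ≤ crossZ (c - b) w ∧ -m₃ ≤ crossZ (a - c) w := by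
    have hD := h.pos
    have e2 : ∀ m : ℤ, crossZ (c - b) (m • ((a - c) + (b - c))) =
        m * crossZ (b - a) (c - a) := fun m => by
      simp only [crossZ, Prod.smul_fst, Prod.smul_snd, Prod.fst_sub, Prod.snd_sub, Prod.fst_add,
        Prod.snd_add, smul_eq_mul]
      ring
    have e3 : ∀ m : ℤ, crossZ (a - c) (m • ((a - c) + (b - c))) =
        m * crossZ (b - a) (c - a) := fun m => by
      simp only [crossZ, Prod.smul_fst, Prod.smul_snd, Prod.fst_sub, Prod.snd_sub, Prod.fst_add,
        Prod.snd_add, smul_eq_mul]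
      ring
    have hm : max 0 (max (-m₂) (-m₃)) ≤ max 0 (max (-m₂) (-m₃)) * crossZ (b - a) (c - a) :=
      le_mul_of_one_le_right (le_max_left _ _) hD
    exact ⟨max 0 (max (-m₂) (-m₃)) • ((a - c) + (b - c)), by rw [e2]; omega, by rw [e3]; omega⟩
  have := Fintype.ofFinite (T → A)
  obtain ⟨x, hx, x', hx', hne, hxx⟩ := Finset.exists_ne_map_eq_of_card_lt_of_maps_to
    (s := s) (t := Finset.univ) (by rw [Finset.card_univ, hs, Nat.card_eq_fintype_card]; omega)
    (f := fun x (q : T) => x (-w + q)) (fun x _ => Finset.mem_coe.2 (Finset.mem_univ _))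
  have hmem : d (x, x') ∈ d '' (s ×ˢ s : Finset (Config A × Config A)) :=
    ⟨(x, x'), by simpa using ⟨hx, hx'⟩, rfl⟩
  have h2 := hm₂ _ hmem
  have h3 := hm₃ _ hmem
  have := hcone.shift hX (-w) (hsX hx) (hsX hx')
    (fun q hq => congrFun hxx ⟨q, hq⟩) (w + d (x, x')) (by
      simp only [Set.mem_ofPred_eq, crossZ_add_right]; omega)
  rw [neg_add_cancel_left] at this
  exact hd (x, x') hne this

lemma AlongEdge.exists_smul {e a b c : Z2} (hD : 0 < crossZ (b - a) (c - a))
    (h : AlongEdge e a b c) : ∃ r : ℝ, 0 < r ∧ toR2 e = r • (toR2 b - toR2 a) := by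
  obtain ⟨h1, h2⟩ := h
  have hD' : (0 : ℝ) < crossZ (b - a) (c - a) := by exact_mod_cast hD
  refine ⟨crossZ e (c - a) / crossZ (b - a) (c - a), div_pos (by exact_mod_cast h2) hD', ?_⟩
  have h1' : (crossZ e (b - a) : ℝ) = 0 := by exact_mod_cast h1
  ext
  · simp only [toR2, Prod.smul_fst, Prod.fst_sub, smul_eq_mul]
    rw [div_mul_eq_mul_div, eq_div_iff hD'.ne']
    simp only [crossZ, Prod.fst_sub, Prod.snd_sub] at *
    push_cast at *
    linear_combination (-(c.1 - a.1) : ℝ) * h1'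
  · simp only [toR2, Prod.smul_snd, Prod.snd_sub, smul_eq_mul]
    rw [div_mul_eq_mul_div, eq_div_iff hD'.ne']
    simp only [crossZ, Prod.fst_sub, Prod.snd_sub] at *
    push_cast at *
    linear_combination (-(c.2 - a.2) : ℝ) * h1'

end Triangle

section Polygon

lemma toR2_add (p q : Z2) : toR2 (p + q) = toR2 p + toR2 q := by
  ext <;> simp [toR2]

lemma toR2_sub (p q : Z2) : toR2 (p - q) = toR2 p - toR2 q := by
  ext <;> simp [toR2]

lemma toR2_injective : Function.Injective toR2 := by
  intro p q h
  simp only [toR2, Prod.mk.injEq, Int.cast_inj] at h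
  exact Prod.ext h.1 h.2

/-- A homothety commutes with taking convex hulls. -/
lemma convexHull_image_homothety (r : ℝ) (t : ℝ × ℝ) (S : Set (ℝ × ℝ)) :
    convexHull ℝ ((fun w => r • w + t) '' S) = (fun w => r • w + t) '' convexHull ℝ S := by
  exact (AffineMap.image_convexHull (r • AffineMap.id ℝ (ℝ × ℝ) + AffineMap.const ℝ _ t) S).symm

lemma TranslateOf.symm {P Q : IntPolygon} (h : TranslateOf P Q) : TranslateOf Q P := by
  obtain ⟨t, ht⟩ := h
  refine ⟨-t, ?_⟩
  rw [ht, Set.image_image]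
  simp

lemma Homothetic.symm {P Q : IntPolygon} (h : Homothetic P Q) : Homothetic Q P := by
  obtain ⟨r, hr, t, ht⟩ := h
  refine ⟨r⁻¹, inv_pos.2 hr, -(r⁻¹ • t), ?_⟩
  rw [ht, Set.image_image]
  simp [smul_smul, hr.ne']

namespace IntPolygon

/-- The translate of a polygon by an integer vector. -/
def translate (P : IntPolygon) (u : Z2) : IntPolygon where
  n := P.n
  vert := fun i => P.vert i + u
  convex := by
    intro i j hj hj1
    simpa only [add_sub_add_right_eq_sub] using P.convex i j hj hj1

lemma carrier_translate (P : IntPolygon) (u : Z2) :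
    (P.translate u).carrier = (fun w => w + toR2 u) '' P.carrier := by
  have := convexHull_image_homothety 1 (toR2 u) (Set.range fun i => toR2 (P.vert i))
  simp only [one_smul] at this
  rw [carrier, carrier, ← this, ← Set.range_comp]
  simp only [translate, toR2_add, Function.comp_def]

lemma convex_carrier (P : IntPolygon) : Convex ℝ P.carrier := convex_convexHull ℝ _

end IntPolygon

lemma IsCodingPolygon.translate {A : Type*} {X : Set (Config A)} (hX : IsSubshift X)
    {P : IntPolygon} (h : IsCodingPolygon X P) (u : Z2) : IsCodingPolygon X (P.translate u) := by
  intro i x hx x' hx' hxx p hp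
  obtain rfl : p = P.vert i + u := toR2_injective hp
  have := h i _ (hX.2 u x hx) _ (hX.2 u x' hx') (fun q hq => hxx (u + q) ⟨?_, ?_⟩) (P.vert i) rfl
  · simpa [shiftAct, add_comm u] using this
  · rw [P.carrier_translate]
    exact ⟨toR2 q, hq.1, by rw [toR2_add, add_comm]⟩
  · intro h0
    refine hq.2 (congrArg toR2 ?_)
    have : u + q = P.vert i + u := toR2_injective h0
    rw [add_comm (P.vert i)] at this
    exact add_left_cancel this

lemma HasRecodingPolygon.translate {A : Type*} {X : Set (Config A)} {P : IntPolygon}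
    (h : HasRecodingPolygon X P) (u : Z2) : HasRecodingPolygon X (P.translate u) := by
  obtain ⟨A', hA', Y, hY, hXY, hP⟩ := h
  exact ⟨A', hA', Y, hY, hXY, hP.translate hY u⟩

/-- A homothetic copy `Q` of `P` that is not larger than `P` has an integer translate contained
in `P`. -/
lemma IntPolygon.exists_translate_subset {P Q : IntPolygon} {r : ℝ} (hr : 0 < r) (hr1 : r ≤ 1)
    {t : ℝ × ℝ} (h : Q.carrier = (fun w => r • w + t) '' P.carrier) :
    ∃ u : Z2, (Q.translate u).carrier ⊆ P.carrier := by
  obtain ⟨x, hx⟩ : (P.carrier.extremePoints ℝ).Nonempty :=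
    ((Set.finite_range _).isCompact_convexHull ℝ).extremePoints_nonempty
      ((convexHull_nonempty_iff).2 (Set.range_nonempty _))
  obtain ⟨i, rfl⟩ := extremePoints_convexHull_subset hx
  have hx' : r • toR2 (P.vert i) + t ∈ Q.carrier.extremePoints ℝ := by
    rw [h]
    refine ⟨⟨_, hx.1, rfl⟩, ?_⟩
    rintro _ ⟨y, hy, rfl⟩ _ ⟨z, hz, rfl⟩ ⟨α, β, hα, hβ, hαβ, hc⟩
    have hyz : α • y + β • z = toR2 (P.vert i) := by
      refine smul_right_injective _ hr.ne' (add_right_cancel (b := t) ?_)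
      simp only
      rw [← hc]
      have : t = (α + β) • t := by rw [hαβ, one_smul]
      nth_rw 1 [this]
      module
    rw [hx.2 hy hz ⟨α, β, hα, hβ, hαβ, hyz⟩]
  obtain ⟨j, hj⟩ := extremePoints_convexHull_subset hx'
  refine ⟨P.vert i - Q.vert j, ?_⟩
  rw [Q.carrier_translate, h]
  rintro _ ⟨_, ⟨y, hy, rfl⟩, rfl⟩
  have hj' : toR2 (Q.vert j) = r • toR2 (P.vert i) + t := hj
  have : r • y + t + toR2 (P.vert i - Q.vert j) = r • y + (1 - r) • toR2 (P.vert i) := by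
    rw [toR2_sub, hj']; module
  simp only [this]
  exact P.convex_carrier hy hx.1 hr.le (by linarith) (by ring)

lemma IsMinimalRecodingPolygon.n_eq {A : Type*} {X : Set (Config A)} {P Q : IntPolygon}
    (hP : IsMinimalRecodingPolygon X P) (hQ : IsMinimalRecodingPolygon X Q) : P.n = Q.n :=
  le_antisymm (hP.2.1 Q hQ.1) (hQ.2.1 P hP.1)

lemma IsMinimalRecodingPolygon.translateOf {A : Type*} {X : Set (Config A)} {P Q : IntPolygon}
    (hP : IsMinimalRecodingPolygon X P) (hQ : IsMinimalRecodingPolygon X Q)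
    (h : Homothetic P Q) : TranslateOf P Q := by
  have of_le_one : ∀ {P Q : IntPolygon}, IsMinimalRecodingPolygon X P →
      IsMinimalRecodingPolygon X Q → ∀ {r : ℝ}, 0 < r → r ≤ 1 → ∀ {t : ℝ × ℝ},
      Q.carrier = (fun w => r • w + t) '' P.carrier → TranslateOf P Q := by
    intro P Q hP hQ r hr hr1 t h
    obtain ⟨u, hu⟩ := IntPolygon.exists_translate_subset hr hr1 h
    exact TranslateOf.symm ⟨toR2 u, by
      rw [← Q.carrier_translate, hP.2.2 _ (hQ.1.translate u) (hQ.n_eq hP) hu]⟩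
  obtain ⟨r, hr, t, ht⟩ := id h
  rcases le_total r 1 with hr1 | hr1
  · exact of_le_one hP hQ hr hr1 ht
  · refine (of_le_one hQ hP (inv_pos.2 hr) (inv_le_one_of_one_le₀ hr1) (t := -(r⁻¹ • t)) ?_).symm
    rw [ht, Set.image_image]
    simp [smul_smul, hr.ne']

lemma crossR_toR2 (u v : Z2) : crossR (toR2 u) (toR2 v) = crossZ u v := by
  simp [crossR, crossZ, toR2]

lemma convex_leftOf (e a : ℝ × ℝ) : Convex ℝ {p | 0 ≤ crossR e (p - a)} := by
  intro p hp q hq α β hα hβ hαβ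
  simp only [crossR, Set.mem_ofPred_eq, Prod.fst_sub, Prod.snd_sub, Prod.fst_add, Prod.snd_add,
    Prod.smul_fst, Prod.smul_snd, smul_eq_mul] at *
  have h := add_nonneg (mul_nonneg hα hp) (mul_nonneg hβ hq)
  obtain rfl : β = 1 - α := by linarith
  linear_combination h

lemma mem_triZ_of_mem_convexHull {a b c p : Z2} (hD : 0 < crossZ (b - a) (c - a))
    (hp : toR2 p ∈ convexHull ℝ {toR2 a, toR2 b, toR2 c}) : p ∈ triZ a b c := by
  have key : ∀ e w : Z2, 0 ≤ crossZ e (a - w) → 0 ≤ crossZ e (b - w) → 0 ≤ crossZ e (c - w) →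
      0 ≤ crossZ e (p - w) := by
    intro e w ha hb hc
    have := convexHull_min (t := {q | 0 ≤ crossR (toR2 e) (q - toR2 w)}) (by
      rintro q (rfl | rfl | rfl) <;>
        simp only [Set.mem_ofPred_eq, ← toR2_sub, crossR_toR2] <;> exact_mod_cast (by assumption))
      (convex_leftOf _ _) hp
    simp only [Set.mem_ofPred_eq, ← toR2_sub, crossR_toR2] at this
    exact_mod_cast this
  refine ⟨key _ _ ?_ ?_ ?_, key _ _ ?_ ?_ ?_, key _ _ ?_ ?_ ?_⟩ <;>
    simp only [crossZ, Prod.fst_sub, Prod.snd_sub] at * <;> linarith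

lemma IntPolygon.exists_triangle (P : IntPolygon) (hP : P.n = 0) :
    ∃ a b c : Z2, P.carrier = convexHull ℝ {toR2 a, toR2 b, toR2 c} ∧
      ∀ {A : Type} (Y : Set (Config A)), IsCodingPolygon Y P → CodingTriangle Y a b c := by
  obtain ⟨n, vert, convex⟩ := P
  obtain rfl : n = 0 := hP
  have hD : 0 < crossZ (vert 1 - vert 0) (vert 2 - vert 0) := convex 0 2 (by decide) (by decide)
  have hcar : IntPolygon.carrier ⟨0, vert, convex⟩ =
      convexHull ℝ {toR2 (vert 0), toR2 (vert 1), toR2 (vert 2)} := by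
    rw [IntPolygon.carrier]
    congr 1
    ext p
    simp [Fin.exists_fin_succ, eq_comm]
  refine ⟨vert 0, vert 1, vert 2, hcar, fun Y hY => ?_⟩
  have key : ∀ i : Fin 3, CodesZ Y (triZ (vert 0) (vert 1) (vert 2) \ {vert i}) {vert i} := by
    intro i x hx x' hx' hxx p hp
    refine hY i x hx x' hx' (fun q hq => hxx q ⟨?_, ?_⟩) p (congrArg toR2 hp)
    · exact mem_triZ_of_mem_convexHull hD (hcar ▸ hq.1)
    · exact fun h0 => hq.2 (congrArg toR2 h0)
  exact ⟨hD, key 0, key 1, key 2⟩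

/-- Two triangles whose edges are parallel with the same orientation are homothetic. -/
lemma convexHull_eq_of_parallel {a b c a' b' c' : ℝ × ℝ} {r s t : ℝ}
    (hne : crossR (b' - a') (c' - a') ≠ 0) (h1 : b - a = r • (b' - a'))
    (h2 : c - b = s • (c' - b')) (h3 : a - c = t • (a' - c')) :
    convexHull ℝ {a, b, c} =
      (fun w => r • w + (a - r • a')) '' convexHull ℝ {a', b', c'} := by
  have hsum : r • (b' - a') + s • (c' - b') + t • (a' - c') = 0 := by
    rw [← h1, ← h2, ← h3]; abel
  have hx := congrArg Prod.fst hsum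
  have hy := congrArg Prod.snd hsum
  simp only [crossR, Prod.fst_sub, Prod.snd_sub, Prod.fst_add, Prod.snd_add,
    Prod.smul_fst, Prod.smul_snd, smul_eq_mul, Prod.fst_zero, Prod.snd_zero] at hne hx hy
  have hrt : r = t := by
    refine mul_right_cancel₀ hne ?_
    linear_combination (c'.2 - b'.2) * hx - (c'.1 - b'.1) * hy
  subst hrt
  rw [← convexHull_image_homothety, Set.image_insert_eq, Set.image_pair]
  have e1 : r • a' + (a - r • a') = a := by abel
  have e2 : r • b' + (a - r • a') = b := by
    rw [eq_add_of_sub_eq h1]; module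
  have e3 : r • c' + (a - r • a') = c := by
    have : c = a - r • (a' - c') := by rw [← h3]; abel
    rw [this]; module
  rw [e1, e2, e3]

/-- Oriented parallelism forces the edges of one triangle to match cyclically those of another. -/
lemma exists_smul_of_alongEdge {a b c a' b' c' : Z2} (hD : 0 < crossZ (b - a) (c - a))
    (hD' : 0 < crossZ (b' - a') (c' - a')) (h1 : AlongEdge (b - a) a' b' c')
    (h2 : AlongEdge (c - b) a' b' c' ∨ AlongEdge (c - b) b' c' a' ∨ AlongEdge (c - b) c' a' b')
    (h3 : AlongEdge (a - c) a' b' c' ∨ AlongEdge (a - c) b' c' a' ∨ AlongEdge (a - c) c' a' b') :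
    ∃ r : ℝ, 0 < r ∧ ∃ t, convexHull ℝ {toR2 a, toR2 b, toR2 c} =
      (fun w => r • w + t) '' convexHull ℝ {toR2 a', toR2 b', toR2 c'} := by
  have hDb : 0 < crossZ (c' - b') (a' - b') := by rwa [crossZ_rotate]
  have hDc : 0 < crossZ (a' - c') (b' - c') := by rwa [crossZ_rotate]
  have hDR : 0 < crossR (toR2 b' - toR2 a') (toR2 c' - toR2 a') := by
    rw [← toR2_sub, ← toR2_sub, crossR_toR2]; exact_mod_cast hD'
  have h12 : 0 < crossR (toR2 (b - a)) (toR2 (c - b)) := by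
    rw [crossR_toR2]
    simp only [crossZ, Prod.fst_sub, Prod.snd_sub] at *
    exact_mod_cast (by linarith)
  have h31 : 0 < crossR (toR2 (a - c)) (toR2 (b - a)) := by
    rw [crossR_toR2]
    simp only [crossZ, Prod.fst_sub, Prod.snd_sub] at *
    exact_mod_cast (by linarith)
  have cross_smul : ∀ (r s : ℝ) (u v : ℝ × ℝ),
      crossR (r • u) (s • v) = r * s * crossR u v := fun r s u v => by
    simp only [crossR, Prod.smul_fst, Prod.smul_snd, smul_eq_mul]; ring
  have c0 : ∀ u : ℝ × ℝ, crossR u u = 0 := fun u => by simp only [crossR]; ring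
  have c13 : crossR (toR2 b' - toR2 a') (toR2 a' - toR2 c') =
      - crossR (toR2 b' - toR2 a') (toR2 c' - toR2 a') := by
    simp only [crossR, Prod.fst_sub, Prod.snd_sub]; ring
  have c21 : crossR (toR2 c' - toR2 b') (toR2 b' - toR2 a') =
      - crossR (toR2 b' - toR2 a') (toR2 c' - toR2 a') := by
    simp only [crossR, Prod.fst_sub, Prod.snd_sub]; ring
  obtain ⟨r, hr, e1⟩ := h1.exists_smul hD'
  rw [e1] at h12 h31
  have e2 : ∃ s : ℝ, toR2 (c - b) = s • (toR2 c' - toR2 b') := by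
    rcases h2 with h2 | h2 | h2
    · obtain ⟨s, hs, e⟩ := h2.exists_smul hD'
      rw [e, cross_smul, c0, mul_zero] at h12
      exact absurd h12 (lt_irrefl _)
    · obtain ⟨s, hs, e⟩ := h2.exists_smul hDb
      exact ⟨s, e⟩
    · obtain ⟨s, hs, e⟩ := h2.exists_smul hDc
      rw [e, cross_smul, c13] at h12
      have := mul_pos (mul_pos hr hs) hDR
      linarith
  have e3 : ∃ s : ℝ, toR2 (a - c) = s • (toR2 a' - toR2 c') := by
    rcases h3 with h3 | h3 | h3
    · obtain ⟨s, hs, e⟩ := h3.exists_smul hD'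
      rw [e, cross_smul, c0, mul_zero] at h31
      exact absurd h31 (lt_irrefl _)
    · obtain ⟨s, hs, e⟩ := h3.exists_smul hDb
      rw [e, cross_smul, c21] at h31
      have := mul_pos (mul_pos hs hr) hDR
      linarith
    · obtain ⟨s, hs, e⟩ := h3.exists_smul hDc
      exact ⟨s, e⟩
  obtain ⟨s, e2⟩ := e2
  obtain ⟨t, e3⟩ := e3
  rw [toR2_sub] at e1 e2 e3
  exact ⟨r, hr, _, convexHull_eq_of_parallel hDR.ne' e1 e2 e3⟩

lemma IsRecoding.infinite {A A' : Type*} {X : Set (Config A)} {Y : Set (Config A')}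
    (h : IsRecoding X Y) (hX : X.Infinite) : Y.Infinite := by
  let : TopologicalSpace A := ⊥
  let : TopologicalSpace A' := ⊥
  obtain ⟨F, -, Ψ, -⟩ := h
  have := hX.to_subtype
  exact Set.infinite_coe_iff.1 (Infinite.of_injective Ψ Ψ.injective)

/-- Any two triangular recoding polygons of an infinite subshift are homothetic. -/
lemma homothetic_of_n_eq_zero {A : Type} [Finite A] {X : Set (Config A)} (hX : IsSubshift X)
    (hInf : X.Infinite) {P Q : IntPolygon} (hP : HasRecodingPolygon X P)
    (hQ : HasRecodingPolygon X Q) (hPn : P.n = 0) (hQn : Q.n = 0) : Homothetic P Q := by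
  obtain ⟨B, hB, Y, hY, hXY, hPY⟩ := hP
  obtain ⟨B', hB', Z, hZ, hXZ, hQZ⟩ := hQ
  obtain ⟨a, b, c, hPc, hPt⟩ := P.exists_triangle hPn
  obtain ⟨a', b', c', hQc, hQt⟩ := Q.exists_triangle hQn
  have hPt := hPt Y hPY
  have hQt := hQt Z hQZ
  have key : ∀ {a b c : Z2}, CodingTriangle Y a b c → AlongEdge (b - a) a' b' c' ∨
      AlongEdge (b - a) b' c' a' ∨ AlongEdge (b - a) c' a' b' := by
    intro a b c h
    refine hQt.alongEdge hZ ?_ fun he => hXY.infinite hInf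
      (h.finite_of_finitelyExpansive hY ((he.of_recoding hInf hZ hXZ).recoding hX hXY))
    intro h0
    have := h.pos
    simp [h0, crossZ] at this
  have hQP : Homothetic Q P := by
    have k1 := key hPt
    have k2 := key hPt.rotate
    have k3 := key hPt.rotate.rotate
    rw [Homothetic, hPc, hQc]
    have rot : ∀ x y z : ℝ × ℝ, ({x, y, z} : Set (ℝ × ℝ)) = {y, z, x} := by
      intro x y z; ext; simp only [Set.mem_insert_iff, Set.mem_singleton_iff]; tauto
    rcases k1 with k1 | k1 | k1
    · exact exists_smul_of_alongEdge hPt.pos hQt.pos k1 k2 k3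
    · rw [rot (toR2 a')]
      exact exists_smul_of_alongEdge hPt.pos hQt.rotate.pos k1 (by tauto) (by tauto)
    · rw [← rot (toR2 c')]
      exact exists_smul_of_alongEdge hPt.pos hQt.rotate.rotate.pos k1 (by tauto) (by tauto)
  exact hQP.symm

end Polygon

/-- any two homothetic minimal recoding polygons for an infinite
polygonal subshift differ by a translation; in particular if some minimal recoding
polygon is a triangle, then any two minimal recoding polygons differ by a
translation. -/
theorem statement18 {A : Type} [Fintype A] [Nonempty A] (X : Set (Config A))
    (hX : IsSubshift X) (hInf : X.Infinite)
    (hpoly : ∃ P₀ : IntPolygon, IsCodingPolygon X P₀) :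
    (∀ P Q : IntPolygon, IsMinimalRecodingPolygon X P → IsMinimalRecodingPolygon X Q →
      Homothetic P Q → TranslateOf P Q) ∧
    ((∃ P : IntPolygon, IsMinimalRecodingPolygon X P ∧ P.n = 0) →
      ∀ P Q : IntPolygon, IsMinimalRecodingPolygon X P → IsMinimalRecodingPolygon X Q →
        TranslateOf P Q) := by
  refine ⟨fun P Q hP hQ h => hP.translateOf hQ h, ?_⟩
  rintro ⟨T, hT, hTn⟩ P Q hP hQ
  exact hP.translateOf hQ (homothetic_of_n_eq_zero hX hInf hP.1 hQ.1 ((hP.n_eq hT).trans hTn)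
    ((hQ.n_eq hT).trans hTn))

end PolygonalShifts
end

section
/- Let T be an integer triangle and let X and Y be ℤ²-subshifts, both polygonal with respect to T. Assume that for every v ∈ ℝ² the iterated limits defining the directional entropies h_v(X) and h_v(Y) exist, and that the entropy seminorms ‖·‖_X and ‖·‖_Y are not identically zero. Then there is a constant c > 0 such that ‖v‖_X = c·‖v‖_Y for all v ∈ ℝ². -/
namespace PolygonalShifts

/-- The number of distinct restrictions of elements of `X` to `S ∩ ℤ²`. -/
noncomputable def patternCount {A : Type*} (X : Set (Config A)) (S : Set (ℝ × ℝ)) : ℕ :=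
  Set.ncard ((fun x : Config A => fun p : {q : Z2 // toR2 q ∈ S} => x p.1) '' X)

/-- The segment `I_v = {t·v : 0 ≤ t ≤ 1}`. -/
def segment01 (v : ℝ × ℝ) : Set (ℝ × ℝ) := {w | ∃ t : ℝ, 0 ≤ t ∧ t ≤ 1 ∧ w = t • v}

/-- Euclidean distance on `ℝ²`. -/
noncomputable def edist2 (u w : ℝ × ℝ) : ℝ :=
  Real.sqrt ((u.1 - w.1) ^ 2 + (u.2 - w.2) ^ 2)

/-- The open `r`-neighborhood `K_r = {u : dist(u, K) < r}` of `K ⊆ ℝ²`. -/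
def nbhd (K : Set (ℝ × ℝ)) (r : ℝ) : Set (ℝ × ℝ) := {u | ∃ w ∈ K, edist2 u w < r}

/-- The directional entropy `h_v(X)` exists and equals `h`: the iterated limit
`lim_{r→∞} lim_{n→∞} ln P(X, (n·I_v)_r) / n` exists and equals `h`. -/
def HasDirEntropy {A : Type*} (X : Set (Config A)) (v : ℝ × ℝ) (h : ℝ) : Prop :=
  ∃ g : ℝ → ℝ,
    (∀ r : ℝ, 0 < r → Filter.Tendsto
      (fun n : ℕ => Real.log ((patternCount X (nbhd (segment01 ((n : ℝ) • v)) r) : ℝ)) / n)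
      Filter.atTop (nhds (g r))) ∧
    Filter.Tendsto g Filter.atTop (nhds h)

open Filter Topology

/-! ### Elementary geometry -/

lemma abs_sub_lt_of_edist2_lt {u w : ℝ × ℝ} {r : ℝ} (h : edist2 u w < r) :
    |u.1 - w.1| < r ∧ |u.2 - w.2| < r :=
  ⟨(Real.abs_le_sqrt (by nlinarith [sq_nonneg (u.2 - w.2)])).trans_lt h,
    (Real.abs_le_sqrt (by nlinarith [sq_nonneg (u.1 - w.1)])).trans_lt h⟩

lemma edist2_le_abs_add_abs (u w : ℝ × ℝ) : edist2 u w ≤ |u.1 - w.1| + |u.2 - w.2| := by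
  unfold edist2
  apply Real.sqrt_le_iff.mpr
  refine ⟨by positivity, ?_⟩
  have h1 := sq_abs (u.1 - w.1)
  have h2 := sq_abs (u.2 - w.2)
  nlinarith [mul_nonneg (abs_nonneg (u.1 - w.1)) (abs_nonneg (u.2 - w.2))]

lemma finite_lattice_nbhd_segment01 (v : ℝ × ℝ) (r : ℝ) :
    {p : Z2 | toR2 p ∈ nbhd (segment01 v) r}.Finite := by
  obtain ⟨N, hN⟩ := exists_nat_ge (|v.1| + |v.2| + r)
  refine (Set.finite_Icc ((-N, -N) : Z2) (N, N)).subset ?_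
  rintro p ⟨w, ⟨t, ht0, ht1, rfl⟩, hpw⟩
  obtain ⟨h1, h2⟩ := abs_sub_lt_of_edist2_lt hpw
  have key : ∀ y : ℝ, |t * y| ≤ |y| := fun y => by
    rw [abs_mul, abs_of_nonneg ht0]
    exact mul_le_of_le_one_left (abs_nonneg y) ht1
  have k1 := abs_le.mp (key v.1)
  have k2 := abs_le.mp (key v.2)
  simp only [toR2, Prod.smul_fst, Prod.smul_snd, smul_eq_mul, abs_lt] at h1 h2
  have n1 := abs_nonneg v.1
  have n2 := abs_nonneg v.2
  refine ⟨⟨?_, ?_⟩, ⟨?_, ?_⟩⟩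
  · have : (-(N : ℝ)) ≤ p.1 := by linarith
    exact_mod_cast this
  · have : (-(N : ℝ)) ≤ p.2 := by linarith
    exact_mod_cast this
  · have : (p.1 : ℝ) ≤ N := by linarith
    exact_mod_cast this
  · have : (p.2 : ℝ) ≤ N := by linarith
    exact_mod_cast this

lemma le_of_mem_convexHull_triple {a b c w : ℝ × ℝ} {k m n : ℝ}
    (ha : k ≤ m * a.1 + n * a.2) (hb : k ≤ m * b.1 + n * b.2) (hc : k ≤ m * c.1 + n * c.2)
    (hw : w ∈ convexHull ℝ {a, b, c}) : k ≤ m * w.1 + n * w.2 := by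
  have hlin : IsLinearMap ℝ fun w : ℝ × ℝ => m * w.1 + n * w.2 :=
    ⟨fun x y => by simp only [Prod.fst_add, Prod.snd_add]; ring,
      fun r x => by simp only [Prod.smul_fst, Prod.smul_snd, smul_eq_mul]; ring⟩
  refine convexHull_min ?_ (convex_halfSpace_ge hlin k) hw
  rintro x (rfl | rfl | rfl) <;> assumption

/-! ### Pattern counts and directional entropy -/

lemma patternCount_le_of_codes {A : Type*} [Finite A] {X : Set (Config A)}
    (hX : ∀ u : Z2, ∀ x ∈ X, shiftAct u x ∈ X) {S S' : Set (ℝ × ℝ)}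
    (hfin : {p : Z2 | toR2 p ∈ S'}.Finite) (z : Z2)
    (h : ∀ x ∈ X, ∀ x' ∈ X, (∀ p : Z2, toR2 p ∈ S' → x p = x' p) →
      ∀ p : Z2, toR2 p ∈ S → x (z + p) = x' (z + p)) :
    patternCount X S ≤ patternCount X S' := by
  rcases X.eq_empty_or_nonempty with rfl | ⟨x₀, _⟩
  · simp [patternCount]
  have : Finite {q : Z2 // toR2 q ∈ S'} := hfin.to_subtype
  have : Nonempty (Config A) := ⟨x₀⟩
  unfold patternCount
  set f : Config A → {q : Z2 // toR2 q ∈ S} → A := fun x p => x p.1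
  set f' : Config A → {q : Z2 // toR2 q ∈ S'} → A := fun x p => x p.1
  have hsub : f '' X ⊆ (fun π => f (shiftAct z (Function.invFunOn f' X π))) '' (f' '' X) := by
    rintro _ ⟨y, hy, rfl⟩
    have hx := hX (-z) y hy
    have hmem : f' (shiftAct (-z) y) ∈ f' '' X := Set.mem_image_of_mem _ hx
    refine ⟨f' (shiftAct (-z) y), hmem, ?_⟩
    have hr := Function.invFunOn_mem hmem
    have he := Function.invFunOn_eq hmem
    have hc := h _ hr _ hx fun p hp => congrFun he ⟨p, hp⟩
    funext p
    have := hc p.1 p.2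
    simpa [f, shiftAct] using this
  exact (Set.ncard_le_ncard hsub (Set.toFinite _)).trans (Set.ncard_image_le (Set.toFinite _))

lemma HasDirEntropy.nonneg {A : Type*} {X : Set (Config A)} {v : ℝ × ℝ} {h : ℝ}
    (hd : HasDirEntropy X v h) : 0 ≤ h := by
  obtain ⟨g, hg, hl⟩ := hd
  refine ge_of_tendsto hl ?_
  filter_upwards [eventually_gt_atTop 0] with r hr
  exact ge_of_tendsto' (hg r hr) fun n =>
    div_nonneg (Real.log_natCast_nonneg _) (Nat.cast_nonneg n)

lemma HasDirEntropy.le_mul_of_patternCount_le {A : Type*} {X : Set (Config A)} {v w : ℝ × ℝ}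
    {hv hw s : ℝ} (hdv : HasDirEntropy X v hv) (hdw : HasDirEntropy X w hw) (m : ℕ → ℕ)
    (hm : Tendsto m atTop atTop) (hms : Tendsto (fun n : ℕ => (m n : ℝ) / n) atTop (𝓝 s))
    (H : ∀ R : ℝ, 0 < R → ∃ r₀ : ℝ, ∀ r, r₀ ≤ r → ∀ n : ℕ,
      patternCount X (nbhd (segment01 ((n : ℝ) • v)) R) ≤
        patternCount X (nbhd (segment01 ((m n : ℝ) • w)) r)) :
    hv ≤ s * hw := by
  obtain ⟨g, hg, hl⟩ := hdv
  obtain ⟨g', hg', hl'⟩ := hdw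
  refine le_of_tendsto hl ?_
  filter_upwards [eventually_gt_atTop 0] with R hR
  obtain ⟨r₀, hr₀⟩ := H R hR
  refine ge_of_tendsto (hl'.const_mul s) ?_
  filter_upwards [eventually_gt_atTop 0, eventually_ge_atTop r₀] with r hr hrr
  refine le_of_tendsto_of_tendsto (hg R hR) (hms.mul ((hg' r hr).comp hm)) ?_
  filter_upwards [hm.eventually_gt_atTop 0] with n hn
  have hm0 : (m n : ℝ) ≠ 0 := by exact_mod_cast hn.ne'
  have hle := hr₀ r hrr n
  have hlog : ∀ k l : ℕ, k ≤ l → Real.log k ≤ Real.log l := fun k l hkl => by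
    rcases Nat.eq_zero_or_pos k with rfl | hk
    · simpa using Real.log_natCast_nonneg l
    · exact Real.log_le_log (by exact_mod_cast hk) (by exact_mod_cast hkl)
  simp only [Function.comp]
  rw [div_mul_div_comm, mul_comm (n : ℝ), mul_div_mul_left _ _ hm0]
  exact div_le_div_of_nonneg_right (hlog _ _ hle) (Nat.cast_nonneg n)

section Seminorm

variable {A : Type*} [Finite A] {X : Set (Config A)} {h : ℝ × ℝ → ℝ}

lemma dirEntropy_smul_le (hX : ∀ u : Z2, ∀ x ∈ X, shiftAct u x ∈ X)
    (hd : ∀ v, HasDirEntropy X v (h v)) {s : ℝ} (hs : 0 < s) (v : ℝ × ℝ) :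
    h (s • v) ≤ s * h v := by
  have hlim : Tendsto (fun n : ℕ => (⌈s * (n : ℝ)⌉₊ : ℝ) / n) atTop (𝓝 s) :=
    (tendsto_nat_ceil_mul_div_atTop hs.le).comp tendsto_natCast_atTop_atTop
  refine (hd (s • v)).le_mul_of_patternCount_le (hd v) (fun n => ⌈s * (n : ℝ)⌉₊) ?_ hlim ?_
  · exact tendsto_nat_ceil_atTop.comp
      (tendsto_natCast_atTop_atTop.const_mul_atTop hs)
  intro R _
  refine ⟨R, fun r hr n => patternCount_le_of_codes hX (finite_lattice_nbhd_segment01 _ _) 0 ?_⟩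
  intro x _ x' _ hag p hp
  rw [zero_add]
  apply hag
  obtain ⟨w, ⟨t, ht0, ht1, rfl⟩, hpw⟩ := hp
  have hle : s * (n : ℝ) ≤ (⌈s * (n : ℝ)⌉₊ : ℝ) := Nat.le_ceil _
  have hn0 : 0 ≤ s * (n : ℝ) := by positivity
  refine ⟨_, ⟨t * (s * n / (⌈s * (n : ℝ)⌉₊ : ℝ)), by positivity, ?_, ?_⟩, hpw.trans_le hr⟩
  · exact mul_le_one₀ ht1 (by positivity) (div_le_one_of_le₀ hle (by positivity))
  · have : s * n / (⌈s * (n : ℝ)⌉₊ : ℝ) * (⌈s * (n : ℝ)⌉₊ : ℝ) = s * n :=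
      div_mul_cancel_of_imp fun h0 => le_antisymm (h0 ▸ hle) hn0
    rw [smul_smul, smul_smul, smul_smul]
    congr 1
    linear_combination -t * this

lemma dirEntropy_smul (hX : ∀ u : Z2, ∀ x ∈ X, shiftAct u x ∈ X)
    (hd : ∀ v, HasDirEntropy X v (h v)) {s : ℝ} (hs : 0 < s) (v : ℝ × ℝ) :
    h (s • v) = s * h v := by
  refine le_antisymm (dirEntropy_smul_le hX hd hs v) ?_
  have := dirEntropy_smul_le hX hd (inv_pos.mpr hs) (s • v)
  rw [inv_smul_smul₀ hs.ne'] at this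
  calc s * h v ≤ s * (s⁻¹ * h (s • v)) := mul_le_mul_of_nonneg_left this hs.le
    _ = h (s • v) := mul_inv_cancel_left₀ hs.ne' _

lemma dirEntropy_zero (hX : ∀ u : Z2, ∀ x ∈ X, shiftAct u x ∈ X)
    (hd : ∀ v, HasDirEntropy X v (h v)) : h 0 = 0 := by
  have := dirEntropy_smul hX hd (s := 2) two_pos 0
  rw [smul_zero] at this
  linarith

lemma dirEntropy_le_of_codes (hX : ∀ u : Z2, ∀ x ∈ X, shiftAct u x ∈ X)
    (hd : ∀ v, HasDirEntropy X v (h v)) {v w : ℝ × ℝ} (z : ℕ → Z2)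
    (H : ∀ R : ℝ, 0 < R → ∃ r₀ : ℝ, ∀ r, r₀ ≤ r → ∀ n : ℕ, ∀ x ∈ X, ∀ x' ∈ X,
      (∀ p : Z2, toR2 p ∈ nbhd (segment01 ((n : ℝ) • w)) r → x p = x' p) →
      ∀ p : Z2, toR2 p ∈ nbhd (segment01 ((n : ℝ) • v)) R → x (z n + p) = x' (z n + p)) :
    h v ≤ h w := by
  have hlim : Tendsto (fun n : ℕ => (n : ℝ) / n) atTop (𝓝 1) := by
    refine tendsto_const_nhds.congr' ?_
    filter_upwards [eventually_gt_atTop 0] with n hn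
    rw [div_self (by exact_mod_cast hn.ne')]
  rw [← one_mul (h w)]
  refine (hd v).le_mul_of_patternCount_le (hd w) id tendsto_id hlim fun R hR => ?_
  obtain ⟨r₀, hr₀⟩ := H R hR
  exact ⟨r₀, fun r hr n => patternCount_le_of_codes hX (finite_lattice_nbhd_segment01 _ _) (z n)
    (hr₀ r hr n)⟩

lemma dirEntropy_neg_le (hX : ∀ u : Z2, ∀ x ∈ X, shiftAct u x ∈ X)
    (hd : ∀ v, HasDirEntropy X v (h v)) (v : ℝ × ℝ) : h (-v) ≤ h v := by
  refine dirEntropy_le_of_codes hX hd (fun n => (⌊n * v.1⌋, ⌊n * v.2⌋)) fun R _ =>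
    ⟨2 * R + 2, fun r hr n x _ x' _ hag p hp => hag _ ?_⟩
  obtain ⟨w, ⟨t, ht0, ht1, rfl⟩, hpw⟩ := hp
  obtain ⟨h1, h2⟩ := abs_sub_lt_of_edist2_lt hpw
  refine ⟨_, ⟨1 - t, by linarith, by linarith, rfl⟩, ?_⟩
  refine (edist2_le_abs_add_abs _ _).trans_lt ?_
  simp only [toR2, Prod.smul_fst, Prod.smul_snd, smul_eq_mul, Prod.fst_neg, Prod.snd_neg,
    Prod.fst_add, Prod.snd_add, Int.cast_add, abs_lt] at h1 h2 ⊢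
  have key : ∀ y d : ℝ, -R < d - t * (n * -y) ∧ d - t * (n * -y) < R →
      |(⌊n * y⌋ : ℝ) + d - (1 - t) * (n * y)| < R + 1 := fun y d hd => by
    have f1 := Int.floor_le ((n : ℝ) * y)
    have f2 := Int.lt_floor_add_one ((n : ℝ) * y)
    rw [abs_lt]
    constructor <;> nlinarith [hd.1, hd.2]
  linarith [key _ _ h1, key _ _ h2]

lemma dirEntropy_neg (hX : ∀ u : Z2, ∀ x ∈ X, shiftAct u x ∈ X)
    (hd : ∀ v, HasDirEntropy X v (h v)) (v : ℝ × ℝ) : h (-v) = h v :=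
  le_antisymm (dirEntropy_neg_le hX hd v) (by simpa using dirEntropy_neg_le hX hd (-v))

end Seminorm

/-! ### Coding by a triangle -/

/-- Two configurations agree at `p` as soon as they agree on the rest of the translate of the
triangle `abc` whose vertex `c` sits at `p`. -/
lemma eq_of_eq_on_triangle {A : Type*} {X : Set (Config A)}
    (hX : ∀ u : Z2, ∀ x ∈ X, shiftAct u x ∈ X) {a b c : Z2} {s : ℤ}
    (hs : 0 < s * crossZ (b - a) (c - a)) {P : Set (ℝ × ℝ)}
    (hP : P = convexHull ℝ {toR2 a, toR2 b, toR2 c})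
    (hc : Codes X (P \ {toR2 c}) {toR2 c}) {x x' : Config A} (hx : x ∈ X) (hx' : x' ∈ X) (p : Z2)
    (hq : ∀ q : Z2, s * crossZ p (c - a) ≤ s * crossZ q (c - a) →
      s * crossZ (b - a) p - s * crossZ (b - a) (c - a) ≤ s * crossZ (b - a) q →
      s * crossZ q (c - a) + s * crossZ (b - a) q ≤
        s * crossZ p (c - a) + s * crossZ (b - a) p →
      s * crossZ (b - a) q < s * crossZ (b - a) p → x q = x' q) :
    x p = x' p := by
  have key := hc _ (hX (p - c) x hx) _ (hX (p - c) x' hx') ?_ c rfl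
  · simpa [shiftAct] using key
  rintro q ⟨hqP, hqc⟩
  rw [hP] at hqP
  have hsR : (0 : ℝ) < s * crossZ (b - a) (c - a) := by exact_mod_cast hs
  have hne : q ≠ c := fun h => hqc (by rw [h]; rfl)
  obtain ⟨a1, a2⟩ := a
  obtain ⟨b1, b2⟩ := b
  obtain ⟨c1, c2⟩ := c
  obtain ⟨p1, p2⟩ := p
  obtain ⟨q1, q2⟩ := q
  simp only [shiftAct, crossZ, toR2, Prod.mk_sub_mk, Prod.mk_add_mk] at *
  push_cast at hsR
  have i1 := le_of_mem_convexHull_triple (k := s * (c1 * (c2 - a2) - c2 * (c1 - a1)))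
    (m := s * (c2 - a2)) (n := -(s * (c1 - a1))) (by dsimp only; nlinarith)
    (by dsimp only; nlinarith) (by dsimp only; nlinarith) hqP
  have i2 := le_of_mem_convexHull_triple (k := s * ((b1 - a1) * a2 - (b2 - a2) * a1))
    (m := -(s * (b2 - a2))) (n := s * (b1 - a1)) (by dsimp only; nlinarith)
    (by dsimp only; nlinarith) (by dsimp only; nlinarith) hqP
  have i3 := le_of_mem_convexHull_triple
    (k := -(s * (c1 * (c2 - a2) - c2 * (c1 - a1)) + s * ((b1 - a1) * c2 - (b2 - a2) * c1)))
    (m := -(s * (c2 - a2)) + s * (b2 - a2)) (n := s * (c1 - a1) - s * (b1 - a1))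
    (by dsimp only; nlinarith) (by dsimp only; nlinarith) (by dsimp only; nlinarith) hqP
  dsimp only at i1 i2 i3
  norm_cast at i1 i2 i3
  apply hq
  · nlinarith
  · nlinarith
  · nlinarith
  · by_contra! hlt
    apply hne
    have e1 : s * ((b1 - a1) * (q2 - c2) - (b2 - a2) * (q1 - c1)) = 0 := by
      apply le_antisymm <;> nlinarith
    have e2 : s * ((q1 - c1) * (c2 - a2) - (q2 - c2) * (c1 - a1)) = 0 := by
      apply le_antisymm <;> nlinarith
    have d1 : s * ((b1 - a1) * (c2 - a2) - (b2 - a2) * (c1 - a1)) * (q1 - c1) = 0 := by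
      linear_combination (b1 - a1) * e2 + (c1 - a1) * e1
    have d2 : s * ((b1 - a1) * (c2 - a2) - (b2 - a2) * (c1 - a1)) * (q2 - c2) = 0 := by
      linear_combination (b2 - a2) * e2 + (c2 - a2) * e1
    have k1 := (mul_eq_zero.mp d1).resolve_left hs.ne'
    have k2 := (mul_eq_zero.mp d2).resolve_left hs.ne'
    rw [sub_eq_zero.mp k1, sub_eq_zero.mp k2]

/-- A strip around the line `α V = β U` determines the part of the triangle
`U, V ≥ -ρ`, `U + V ≤ L + ρ` lying above it, when the value at a point is determined by the
triangle of size `D` hanging below that point. -/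
lemma forall_of_strip {U V : Z2 → ℤ} {D : ℤ} (hD : 0 < D) {G : Z2 → Prop}
    (step : ∀ p, (∀ q, U p ≤ U q → V p - D ≤ V q → U q + V q ≤ U p + V p → V q < V p → G q) → G p)
    {α β ρ L : ℝ} (hα : 0 ≤ α) (hβ : 0 ≤ β) (hρ : 0 ≤ ρ)
    (base : ∀ p, -ρ ≤ U p → -ρ ≤ V p → (U p : ℝ) + V p ≤ L + ρ →
      |α * V p - β * U p| ≤ (α + β) * (D + ρ) → G p) (p : Z2)
    (hU : -ρ ≤ U p) (hV : -ρ ≤ V p) (hUV : (U p : ℝ) + V p ≤ L + ρ)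
    (hp : -((α + β) * (D + ρ)) ≤ α * V p - β * U p) : G p := by
  have hDR : (0 : ℝ) < D := by exact_mod_cast hD
  induction hN : (V p).toNat using Nat.strong_induction_on generalizing p with
  | _ N ih =>
    subst hN
    by_cases hK : α * V p - β * U p ≤ (α + β) * (D + ρ)
    · exact base p hU hV hUV (abs_le.mpr ⟨hp, hK⟩)
    push Not at hK
    have hVD : (D : ℝ) < V p := by
      by_contra! hle
      nlinarith [mul_le_mul_of_nonneg_left hle hα, mul_le_mul_of_nonneg_left hU hβ,
        mul_nonneg hα hρ, mul_nonneg hβ hDR.le]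
    have hVD' : D < V p := by exact_mod_cast hVD
    refine step p fun q h1 h2 h3 h4 => ?_
    have h1' : (U p : ℝ) ≤ U q := by exact_mod_cast h1
    have h2' : (V p : ℝ) - D ≤ V q := by exact_mod_cast h2
    have h3' : (U q : ℝ) + V q ≤ U p + V p := by exact_mod_cast h3
    refine ih (V q).toNat (by omega) q (by linarith) (by linarith) (by linarith) ?_ rfl
    have h5 : (U q : ℝ) ≤ U p + D := by linarith
    nlinarith [mul_le_mul_of_nonneg_left h2' hα, mul_le_mul_of_nonneg_left h5 hβ,
      mul_nonneg hα hρ, mul_nonneg hβ hρ, mul_nonneg hα hDR.le, mul_nonneg hβ hDR.le]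

/-- A lattice point of the triangle `U, V ≥ -ρ`, `U + V ≤ n (α + β) D + ρ` which is close to the
line through `α e + β f` is close to the segment from `0` to `n (α e + β f)`. -/
lemma mem_nbhd_of_abs_le {e f : Z2} (hD : 0 < crossZ e f) {α β ρ : ℝ} (hα : 0 ≤ α) (hβ : 0 ≤ β)
    (hαβ : 0 < α + β) (hρ : 0 ≤ ρ) {r : ℝ}
    (hr : ((crossZ e f : ℝ) + 3 * ρ) * (|(e.1 : ℝ)| + |(e.2 : ℝ)| + |(f.1 : ℝ)| + |(f.2 : ℝ)|) /
      crossZ e f < r)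
    (n : ℕ) (p : Z2) (hU : -ρ ≤ crossZ p f) (hV : -ρ ≤ crossZ e p)
    (hUV : (crossZ p f : ℝ) + crossZ e p ≤ n * (α + β) * crossZ e f + ρ)
    (hK : |α * crossZ e p - β * crossZ p f| ≤ (α + β) * (crossZ e f + ρ)) :
    toR2 p ∈ nbhd (segment01 ((n : ℝ) • (α • toR2 e + β • toR2 f))) r := by
  have hDR : (0 : ℝ) < crossZ e f := by exact_mod_cast hD
  have hp1 : (crossZ e f : ℝ) * p.1 = crossZ p f * e.1 + crossZ e p * f.1 := by
    simp only [crossZ]; push_cast; ring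
  have hp2 : (crossZ e f : ℝ) * p.2 = crossZ p f * e.2 + crossZ e p * f.2 := by
    simp only [crossZ]; push_cast; ring
  generalize (crossZ e f : ℝ) = D at *
  generalize (crossZ p f : ℝ) = U at *
  generalize (crossZ e p : ℝ) = V at *
  have hl : 0 < (α + β) * D := mul_pos hαβ hDR
  obtain ⟨s, hs0, hsn, hs1, hs2⟩ : ∃ s : ℝ, 0 ≤ s ∧ s ≤ n ∧
      -(2 * ρ) ≤ U + V - s * ((α + β) * D) ∧ U + V - s * ((α + β) * D) ≤ 2 * ρ := by
    rcases le_total (U + V) 0 with h0 | h0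
    · exact ⟨0, le_rfl, Nat.cast_nonneg n, by linarith, by linarith⟩
    rcases le_total (U + V) (n * ((α + β) * D)) with h1 | h1
    · refine ⟨(U + V) / ((α + β) * D), by positivity, (div_le_iff₀ hl).mpr h1, ?_, ?_⟩ <;>
      · rw [div_mul_cancel₀ _ hl.ne']; linarith
    · exact ⟨n, Nat.cast_nonneg n, le_rfl, by linarith, by linarith⟩
  have hK' := abs_le.mp hK
  have hA : |U - s * D * α| ≤ D + 3 * ρ := by
    have e1 : (α + β) * (U - s * D * α) =
        -(α * V - β * U) + α * (U + V - s * ((α + β) * D)) := by ring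
    have m1 := mul_le_mul_of_nonneg_left hs1 hα
    have m2 := mul_le_mul_of_nonneg_left hs2 hα
    have m3 := mul_nonneg hβ hρ
    exact abs_le.mpr ⟨le_of_mul_le_mul_left (by nlinarith) hαβ,
      le_of_mul_le_mul_left (by nlinarith) hαβ⟩
  have hB : |V - s * D * β| ≤ D + 3 * ρ := by
    have e1 : (α + β) * (V - s * D * β) =
        (α * V - β * U) + β * (U + V - s * ((α + β) * D)) := by ring
    have m1 := mul_le_mul_of_nonneg_left hs1 hβ
    have m2 := mul_le_mul_of_nonneg_left hs2 hβ
    have m3 := mul_nonneg hα hρ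
    exact abs_le.mpr ⟨le_of_mul_le_mul_left (by nlinarith) hαβ,
      le_of_mul_le_mul_left (by nlinarith) hαβ⟩
  have hsn' : s / n * n = s := div_mul_cancel_of_imp fun h0 => le_antisymm (h0 ▸ hsn) hs0
  refine ⟨s • (α • toR2 e + β • toR2 f), ⟨s / n, by positivity,
    div_le_one_of_le₀ hsn (Nat.cast_nonneg n), ?_⟩, ?_⟩
  · rw [smul_smul, hsn']
  refine (edist2_le_abs_add_abs _ _).trans_lt (lt_of_le_of_lt ?_ hr)
  have key : ∀ y g k : ℝ, D * y = U * g + V * k →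
      |y - s * (α * g + β * k)| * D ≤ (D + 3 * ρ) * (|g| + |k|) := fun y g k hy => by
    have e1 : (y - s * (α * g + β * k)) * D =
        (U - s * D * α) * g + (V - s * D * β) * k := by linear_combination hy
    rw [← abs_of_pos hDR, ← abs_mul, abs_of_pos hDR, e1]
    refine (abs_add_le _ _).trans ?_
    rw [abs_mul, abs_mul, mul_add]
    gcongr
  rw [le_div_iff₀ hDR]
  simp only [toR2, Prod.smul_fst, Prod.smul_snd, smul_eq_mul, Prod.fst_add, Prod.snd_add]
  linarith [key _ _ _ hp1, key _ _ _ hp2]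

/-- A point near the segment from `0` to `n (α e + β f)` is almost in the triangle with
vertices `0`, `n (α + β) e`, `n (α + β) f`. -/
lemma bounds_of_mem_nbhd {e f : Z2} (hD : 0 < crossZ e f) {α β R : ℝ} (hα : 0 ≤ α) (hβ : 0 ≤ β)
    (n : ℕ) (p : Z2)
    (hp : toR2 p ∈ nbhd (segment01 ((n : ℝ) • (α • toR2 e + β • toR2 f))) R) :
    -(R * (|(e.1 : ℝ)| + |(e.2 : ℝ)| + |(f.1 : ℝ)| + |(f.2 : ℝ)|)) ≤ crossZ p f ∧
    -(R * (|(e.1 : ℝ)| + |(e.2 : ℝ)| + |(f.1 : ℝ)| + |(f.2 : ℝ)|)) ≤ crossZ e p ∧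
    (crossZ p f : ℝ) + crossZ e p ≤ n * (α + β) * crossZ e f +
      R * (|(e.1 : ℝ)| + |(e.2 : ℝ)| + |(f.1 : ℝ)| + |(f.2 : ℝ)|) := by
  have hDR : (0 : ℝ) < crossZ e f := by exact_mod_cast hD
  obtain ⟨w, ⟨t, ht0, ht1, rfl⟩, hpw⟩ := hp
  obtain ⟨h1, h2⟩ := abs_sub_lt_of_edist2_lt hpw
  simp only [toR2, Prod.smul_fst, Prod.smul_snd, smul_eq_mul, Prod.fst_add, Prod.snd_add] at h1 h2
  set d1 := (p.1 : ℝ) - t * (n * (α * e.1 + β * f.1)) with hd1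
  set d2 := (p.2 : ℝ) - t * (n * (α * e.2 + β * f.2)) with hd2
  have hU : (crossZ p f : ℝ) = t * n * α * crossZ e f + (d1 * f.2 - d2 * f.1) := by
    simp only [crossZ, hd1, hd2]; push_cast; ring
  have hV : (crossZ e p : ℝ) = t * n * β * crossZ e f + (e.1 * d2 - e.2 * d1) := by
    simp only [crossZ, hd1, hd2]; push_cast; ring
  have hb : ∀ d g : ℝ, |d| < R → -(R * |g|) ≤ d * g ∧ d * g ≤ R * |g| := fun d g hd => by
    rw [← abs_le, abs_mul]
    gcongr
  have b1 := hb d1 f.2 h1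
  have b2 := hb d2 f.1 h2
  have b3 := hb d2 e.1 h2
  have b4 := hb d1 e.2 h1
  have hR : 0 ≤ R := (abs_nonneg _).trans h1.le
  have z1 : 0 ≤ R * |(e.1 : ℝ)| := by positivity
  have z2 : 0 ≤ R * |(e.2 : ℝ)| := by positivity
  have z3 : 0 ≤ R * |(f.1 : ℝ)| := by positivity
  have z4 : 0 ≤ R * |(f.2 : ℝ)| := by positivity
  have c1 : 0 ≤ t * n * α * crossZ e f := by positivity
  have c2 : 0 ≤ t * n * β * crossZ e f := by positivity
  refine ⟨by linarith, by linarith, ?_⟩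
  have : t * (n * (α + β) * crossZ e f) ≤ n * (α + β) * crossZ e f :=
    mul_le_of_le_one_left (by positivity) ht1
  rw [hU, hV]
  linarith

section Triangle

variable {A : Type*} [Finite A] {X : Set (Config A)} {h : ℝ × ℝ → ℝ} {a b c : Z2}
  {P : Set (ℝ × ℝ)}

lemma dirEntropy_le_of_mem_cone (hX : ∀ u : Z2, ∀ x ∈ X, shiftAct u x ∈ X)
    (hd : ∀ v, HasDirEntropy X v (h v)) (hD : 0 < crossZ (b - a) (c - a))
    (hP : P = convexHull ℝ {toR2 a, toR2 b, toR2 c})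
    (hb : Codes X (P \ {toR2 b}) {toR2 b}) (hc : Codes X (P \ {toR2 c}) {toR2 c})
    {α β α' β' : ℝ} (hα : 0 ≤ α) (hβ : 0 ≤ β) (hα' : 0 ≤ α') (hβ' : 0 ≤ β')
    (hpos : 0 < α + β) (hsum : α' + β' = α + β) :
    h (α' • toR2 (b - a) + β' • toR2 (c - a)) ≤ h (α • toR2 (b - a) + β • toR2 (c - a)) := by
  refine dirEntropy_le_of_codes hX hd (fun _ => 0) fun R hR => ?_
  have hP' : P = convexHull ℝ {toR2 a, toR2 c, toR2 b} := by
    rw [hP, Set.pair_comm]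
  have hanti : ∀ u w : Z2, -1 * crossZ u w = crossZ w u := fun u w => by
    simp only [crossZ]; ring
  have fillc := fun x hx x' hx' => eq_of_eq_on_triangle hX (s := 1) (by simpa using hD) hP hc
    (x := x) (x' := x') hx hx'
  have fillb := fun x hx x' hx' => eq_of_eq_on_triangle hX (s := -1)
    (by simpa [hanti] using hD) hP' hb (x := x) (x' := x') hx hx'
  simp only [one_mul] at fillc
  simp only [hanti] at fillb
  generalize b - a = e at *
  generalize c - a = f at *
  set ρ := R * (|(e.1 : ℝ)| + |(e.2 : ℝ)| + |(f.1 : ℝ)| + |(f.2 : ℝ)|) with hρdef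
  have hρ : 0 ≤ ρ := by positivity
  have hDR : (0 : ℝ) < crossZ e f := by exact_mod_cast hD
  refine ⟨((crossZ e f : ℝ) + 3 * ρ) *
    (|(e.1 : ℝ)| + |(e.2 : ℝ)| + |(f.1 : ℝ)| + |(f.2 : ℝ)|) / crossZ e f + 1, ?_⟩
  intro r hr n x hx x' hx' hag p hp
  rw [zero_add]
  obtain ⟨hU, hV, hUV⟩ := bounds_of_mem_nbhd hD hα' hβ' n p hp
  rw [hsum] at hUV
  have base := fun p hU hV hUV hK => hag p (mem_nbhd_of_abs_le hD hα hβ hpos hρ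
    (r := r) (by linarith) n p hU hV hUV hK)
  have hK0 : 0 ≤ (α + β) * (crossZ e f + ρ) := by positivity
  rcases le_total 0 (α * crossZ e p - β * crossZ p f) with h0 | h0
  · exact forall_of_strip (U := fun p => crossZ p f) (V := fun p => crossZ e p) hD
      (fillc x hx x' hx') hα hβ hρ base p hU hV hUV (by linarith)
  · refine forall_of_strip (U := fun p => crossZ e p) (V := fun p => crossZ p f)
      (G := fun p => x p = x' p) (L := n * (α + β) * crossZ e f) hD
      (fillb x hx x' hx') hβ hα hρ ?_ p hV hU (by linarith) (by linarith)
    intro q h1 h2 h3 h4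
    refine base q h2 h1 (by linarith) ?_
    rwa [abs_sub_comm, add_comm α]

lemma dirEntropy_cone (hX : ∀ u : Z2, ∀ x ∈ X, shiftAct u x ∈ X)
    (hd : ∀ v, HasDirEntropy X v (h v)) (hD : 0 < crossZ (b - a) (c - a))
    (hP : P = convexHull ℝ {toR2 a, toR2 b, toR2 c})
    (hb : Codes X (P \ {toR2 b}) {toR2 b}) (hc : Codes X (P \ {toR2 c}) {toR2 c})
    {α β : ℝ} (hα : 0 ≤ α) (hβ : 0 ≤ β) :
    h (α • toR2 (b - a) + β • toR2 (c - a)) = (α + β) * h (toR2 (b - a)) := by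
  rcases (add_nonneg hα hβ).eq_or_lt with h0 | hpos
  · obtain rfl : α = 0 := by linarith
    obtain rfl : β = 0 := by linarith
    simp [dirEntropy_zero hX hd]
  have h1 : h ((α + β) • toR2 (b - a) + (0 : ℝ) • toR2 (c - a)) =
      (α + β) * h (toR2 (b - a)) := by
    rw [zero_smul, add_zero, dirEntropy_smul hX hd hpos]
  rw [← h1]
  apply le_antisymm
  · exact dirEntropy_le_of_mem_cone hX hd hD hP hb hc hpos.le le_rfl hα hβ (by linarith)
      (by linarith)
  · exact dirEntropy_le_of_mem_cone hX hd hD hP hb hc hα hβ hpos.le le_rfl hpos (by linarith)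

/-- The entropy on each of the three cones spanned by the triangle at its vertices. -/
lemma dirEntropy_triangle (hX : ∀ u : Z2, ∀ x ∈ X, shiftAct u x ∈ X)
    (hd : ∀ v, HasDirEntropy X v (h v)) (hD : 0 < crossZ (b - a) (c - a))
    (hP : P = convexHull ℝ {toR2 a, toR2 b, toR2 c})
    (ha : Codes X (P \ {toR2 a}) {toR2 a})
    (hb : Codes X (P \ {toR2 b}) {toR2 b}) (hc : Codes X (P \ {toR2 c}) {toR2 c})
    {α β : ℝ} (hα : 0 ≤ α) (hβ : 0 ≤ β) :
    h (α • toR2 (b - a) + β • toR2 (c - a)) = (α + β) * h (toR2 (b - a)) ∧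
    h (α • toR2 (c - b) + β • toR2 (a - b)) = (α + β) * h (toR2 (b - a)) ∧
    h (α • toR2 (a - c) + β • toR2 (b - c)) = (α + β) * h (toR2 (b - a)) := by
  have hDb : 0 < crossZ (c - b) (a - b) := by
    simp only [crossZ, Prod.fst_sub, Prod.snd_sub] at hD ⊢; linarith
  have hDc : 0 < crossZ (a - c) (b - c) := by
    simp only [crossZ, Prod.fst_sub, Prod.snd_sub] at hD ⊢; linarith
  have hPb : P = convexHull ℝ {toR2 b, toR2 c, toR2 a} := by
    rw [hP]; congr 1; ext; simp only [Set.mem_insert_iff, Set.mem_singleton_iff]; tauto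
  have hPc : P = convexHull ℝ {toR2 c, toR2 a, toR2 b} := by
    rw [hP]; congr 1; ext; simp only [Set.mem_insert_iff, Set.mem_singleton_iff]; tauto
  have hneg : ∀ u w : Z2, h (toR2 (u - w)) = h (toR2 (w - u)) := fun u w => by
    rw [← dirEntropy_neg hX hd]
    congr 1
    ext <;> simp [toR2]
  have h1 := dirEntropy_cone hX hd hD hP hb hc le_rfl zero_le_one
  have h2 := dirEntropy_cone hX hd hDb hPb hc ha le_rfl zero_le_one
  simp only [zero_smul, one_smul, zero_add, one_mul] at h1 h2
  refine ⟨dirEntropy_cone hX hd hD hP hb hc hα hβ, ?_, ?_⟩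
  · rw [dirEntropy_cone hX hd hDb hPb hc ha hα hβ, ← h2, hneg]
  · rw [dirEntropy_cone hX hd hDc hPc ha hb hα hβ, hneg, h1]

end Triangle

/-- The three cones spanned by a triangle at its vertices, together with their opposites,
cover the plane. -/
lemma exists_mem_cone {a b c : Z2} (hD : 0 < crossZ (b - a) (c - a)) (v : ℝ × ℝ) :
    ∃ α β : ℝ, 0 ≤ α ∧ 0 ≤ β ∧ ∃ w : ℝ × ℝ, (v = w ∨ v = -w) ∧
      (w = α • toR2 (b - a) + β • toR2 (c - a) ∨ w = α • toR2 (c - b) + β • toR2 (a - b) ∨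
        w = α • toR2 (a - c) + β • toR2 (b - c)) := by
  have hDR : (crossZ (b - a) (c - a) : ℝ) ≠ 0 := by exact_mod_cast hD.ne'
  obtain ⟨U, V, rfl⟩ : ∃ U V : ℝ, v = U • toR2 (b - a) + V • toR2 (c - a) := by
    refine ⟨crossR v (toR2 (c - a)) / crossZ (b - a) (c - a),
      crossR (toR2 (b - a)) v / crossZ (b - a) (c - a), ?_⟩
    clear hD
    generalize b - a = e at *
    generalize c - a = f at *
    simp only [crossZ, crossR, toR2] at hDR ⊢
    push_cast at hDR ⊢
    ext <;> simp only [Prod.fst_add, Prod.snd_add, Prod.smul_fst, Prod.smul_snd, smul_eq_mul,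
      div_mul_eq_mul_div, ← add_div] <;> rw [eq_div_iff hDR] <;> ring
  rcases le_total 0 U with hU | hU <;> rcases le_total 0 V with hV | hV
  · exact ⟨U, V, hU, hV, _, Or.inl rfl, Or.inl rfl⟩
  · rcases le_total 0 (U + V) with hUV | hUV
    · refine ⟨-V, U + V, by linarith, hUV, _, Or.inr ?_, Or.inr (Or.inl rfl)⟩
      ext <;> simp [toR2] <;> ring
    · refine ⟨-(U + V), U, by linarith, hU, _, Or.inl ?_, Or.inr (Or.inr rfl)⟩
      ext <;> simp [toR2] <;> ring
  · rcases le_total 0 (U + V) with hUV | hUV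
    · refine ⟨U + V, -U, hUV, by linarith, _, Or.inr ?_, Or.inr (Or.inr rfl)⟩
      ext <;> simp [toR2] <;> ring
    · refine ⟨V, -(U + V), hV, by linarith, _, Or.inl ?_, Or.inr (Or.inl rfl)⟩
      ext <;> simp [toR2] <;> ring
  · refine ⟨-U, -V, by linarith, by linarith, _, Or.inr ?_, Or.inl rfl⟩
    ext <;> simp [toR2] <;> ring

/-- two subshifts polygonal with respect to the same integer triangle,
with everywhere-defined directional entropies and nontrivial entropy seminorms, have
proportional entropy seminorms. -/
theorem statement19 {A A' : Type} [Fintype A] [Nonempty A] [Fintype A'] [Nonempty A']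
    (X : Set (Config A)) (Y : Set (Config A'))
    (hX : IsSubshift X) (hY : IsSubshift Y)
    (T : IntPolygon) (hT : T.n = 0)
    (hXP : Polygonal X T) (hYP : Polygonal Y T)
    (hnX hnY : (ℝ × ℝ) → ℝ)
    (hdX : ∀ v : ℝ × ℝ, HasDirEntropy X v (hnX v))
    (hdY : ∀ v : ℝ × ℝ, HasDirEntropy Y v (hnY v))
    (hXnt : ∃ v : ℝ × ℝ, hnX v ≠ 0) (hYnt : ∃ v : ℝ × ℝ, hnY v ≠ 0) :
    ∃ c : ℝ, 0 < c ∧ ∀ v : ℝ × ℝ, hnX v = c * hnY v := by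
  obtain ⟨n, vert, convex⟩ := T
  obtain rfl : n = 0 := hT
  have hD : 0 < crossZ (vert 1 - vert 0) (vert 2 - vert 0) :=
    convex 0 2 (by decide) (by decide)
  have hP : IntPolygon.carrier ⟨0, vert, convex⟩ =
      convexHull ℝ {toR2 (vert 0), toR2 (vert 1), toR2 (vert 2)} := by
    unfold IntPolygon.carrier
    congr 1
    ext w
    simp only [Set.mem_range, Set.mem_insert_iff, Set.mem_singleton_iff]
    constructor
    · rintro ⟨i, rfl⟩
      fin_cases i <;> simp
    · rintro (rfl | rfl | rfl) <;> exact ⟨_, rfl⟩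
  have hgauge : ∀ v : ℝ × ℝ, ∃ l : ℝ, hnX v = l * hnX (toR2 (vert 1 - vert 0)) ∧
      hnY v = l * hnY (toR2 (vert 1 - vert 0)) := by
    intro v
    obtain ⟨α, β, hα, hβ, w, hvw, hw⟩ := exists_mem_cone hD v
    obtain ⟨x1, x2, x3⟩ := dirEntropy_triangle hX.2 hdX hD hP (hXP.2 0) (hXP.2 1) (hXP.2 2) hα hβ
    obtain ⟨y1, y2, y3⟩ := dirEntropy_triangle hY.2 hdY hD hP (hYP.2 0) (hYP.2 1) (hYP.2 2) hα hβ
    have hvX : hnX v = hnX w := by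
      rcases hvw with rfl | rfl
      exacts [rfl, dirEntropy_neg hX.2 hdX w]
    have hvY : hnY v = hnY w := by
      rcases hvw with rfl | rfl
      exacts [rfl, dirEntropy_neg hY.2 hdY w]
    refine ⟨α + β, ?_⟩
    rw [hvX, hvY]
    rcases hw with rfl | rfl | rfl
    exacts [⟨x1, y1⟩, ⟨x2, y2⟩, ⟨x3, y3⟩]
  set u := toR2 (vert 1 - vert 0)
  have hX0 : 0 < hnX u := by
    refine (hdX u).nonneg.lt_of_ne' fun h0 => ?_
    obtain ⟨v, hv⟩ := hXnt
    obtain ⟨l, hl, -⟩ := hgauge v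
    exact hv (by rw [hl, h0, mul_zero])
  have hY0 : 0 < hnY u := by
    refine (hdY u).nonneg.lt_of_ne' fun h0 => ?_
    obtain ⟨v, hv⟩ := hYnt
    obtain ⟨l, -, hl⟩ := hgauge v
    exact hv (by rw [hl, h0, mul_zero])
  refine ⟨hnX u / hnY u, div_pos hX0 hY0, fun v => ?_⟩
  obtain ⟨l, hlX, hlY⟩ := hgauge v
  rw [hlX, hlY]
  field_simp

end PolygonalShifts
end
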